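/- Let G ∈ C and assume V(G) = H_1 ∪ H_2 ∪ X, where H_1, H_2, X are pairwise disjoint, H_1 is anticomplete to H_2, X is a stable set with |X| ≥ 3, and X ∩ Hub(G) = ∅. Suppose that for i ∈ {1,2} the pair (H_i, X) is a consistent alignment or a consistent connectifier, and that if neither of (H_1,X), (H_2,X) is stellar, then the orders given on X by (H_1,X) and by (H_2,X) coincide. Then, possibly after exchanging the roles of H_1 and H_2: (H_1,X) is a triangular alignment or a triangular connectifier, and (H_2,X) is a spiky connectifier, a stellar connectifier, a spiky alignment, or a wide alignment. Moreover, if (H_1,X) is a triangular alignment, then (H_2,X) is not a wide alignment. -/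

import Mathlib

open Set

/-- `f` enumerates an induced path on `n` vertices in `G`. -/
def IsPathEmb {α : Type} (G : SimpleGraph α) (n : ℕ) (f : Fin n → α) : Prop :=
  Function.Injective f ∧
    ∀ i j : Fin n, G.Adj (f i) (f j) ↔ (i.val = j.val + 1 ∨ j.val = i.val + 1)

/-- `f` enumerates an induced path from `a` to `b`. -/
def IsPathFromTo {α : Type} (G : SimpleGraph α) (n : ℕ) (f : Fin n → α) (a b : α) : Prop :=
  IsPathEmb G n f ∧ ∃ h : 1 ≤ n, f ⟨0, h⟩ = a ∧ f ⟨n - 1, by omega⟩ = b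

/-- The interior (internal vertices) of the path enumerated by `f`. -/
def pathInterior {α : Type} (n : ℕ) (f : Fin n → α) : Set α :=
  {v | ∃ j : Fin n, 0 < j.val ∧ j.val < n - 1 ∧ f j = v}

/-- `k` pairwise internally vertex-disjoint induced paths from `a` to `b` in `G`. -/
def KDisjointPaths {α : Type} (G : SimpleGraph α) (k : ℕ) (a b : α) : Prop :=
  ∃ (n : Fin k → ℕ) (f : ∀ i, Fin (n i) → α),
    (∀ i, IsPathFromTo G (n i) (f i) a b) ∧
    (∀ i j, i ≠ j → Disjoint (pathInterior (n i) (f i)) (pathInterior (n j) (f j)))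

/-- `f` enumerates an induced cycle on `n` vertices. -/
def IsHoleEmb {α : Type} (G : SimpleGraph α) (n : ℕ) (f : ZMod n → α) : Prop :=
  Function.Injective f ∧ ∀ i j : ZMod n, G.Adj (f i) (f j) ↔ (i = j + 1 ∨ j = i + 1)

/-- `H` is the vertex set of a hole of `G` (an induced cycle with at least 4 vertices). -/
def IsHole {α : Type} (G : SimpleGraph α) (H : Set α) : Prop :=
  ∃ (n : ℕ) (f : ZMod n → α), 4 ≤ n ∧ IsHoleEmb G n f ∧ Set.range f = H

/-- `G` has no even hole. -/
def EvenHoleFree {α : Type} (G : SimpleGraph α) : Prop :=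
  ∀ H : Set α, IsHole G H → ¬ Even H.ncard

def Anticomplete {α : Type} (G : SimpleGraph α) (A B : Set α) : Prop :=
  ∀ a ∈ A, ∀ b ∈ B, ¬ G.Adj a b

/-- `X` is a stable (independent) set of `G`. -/
def StableSet {α : Type} (G : SimpleGraph α) (X : Set α) : Prop :=
  ∀ a ∈ X, ∀ b ∈ X, a ≠ b → ¬ G.Adj a b

/-- The open neighborhood of the set `A`. -/
def setNbhd {α : Type} (G : SimpleGraph α) (A : Set α) : Set α :=
  {v | v ∉ A ∧ ∃ a ∈ A, G.Adj v a}

/-- The set `A` induces a connected (nonempty) subgraph of `G`. -/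
def ConnSet {α : Type} (G : SimpleGraph α) (A : Set α) : Prop :=
  (G.induce A).Connected

/-- `D` is a connected component of the subgraph of `G` induced by `S`. -/
def IsCompOf {α : Type} (G : SimpleGraph α) (S D : Set α) : Prop :=
  D ⊆ S ∧ ConnSet G D ∧ ∀ D', D ⊆ D' → D' ⊆ S → ConnSet G D' → D' = D

/-- `G` contains an (induced) theta. -/
def HasTheta {α : Type} (G : SimpleGraph α) : Prop :=
  ∃ (a b : α) (n : Fin 3 → ℕ) (f : ∀ i, Fin (n i) → α),
    a ≠ b ∧ ¬ G.Adj a b ∧ (∀ i, 3 ≤ n i) ∧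
    (∀ i, IsPathFromTo G (n i) (f i) a b) ∧
    (∀ i j : Fin 3, i ≠ j → ∀ (u : Fin (n i)) (v : Fin (n j)),
      0 < u.val → u.val < n i - 1 → 0 < v.val → v.val < n j - 1 →
      f i u ≠ f j v ∧ ¬ G.Adj (f i u) (f j v))

/-- `G` contains an (induced) prism. -/
def HasPrism {α : Type} (G : SimpleGraph α) : Prop :=
  ∃ (n : Fin 3 → ℕ) (f : ∀ i, Fin (n i) → α),
    (∀ i, 2 ≤ n i) ∧ (∀ i, IsPathEmb G (n i) (f i)) ∧
    (∀ i j : Fin 3, i ≠ j → ∀ u v, f i u ≠ f j v) ∧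
    (∀ i j : Fin 3, i ≠ j → ∀ (u : Fin (n i)) (v : Fin (n j)),
      G.Adj (f i u) (f j v) ↔
        ((u.val = 0 ∧ v.val = 0) ∨ (u.val = n i - 1 ∧ v.val = n j - 1)))

/-- The neighbors of `x` in the hole `H`. -/
def holeNbrs {α : Type} (G : SimpleGraph α) (H : Set α) (x : α) : Set α :=
  {v ∈ H | G.Adj x v}

def IsWheel {α : Type} (G : SimpleGraph α) (H : Set α) (x : α) : Prop :=
  IsHole G H ∧ x ∉ H ∧ 3 ≤ (holeNbrs G H x).ncard

def IsTwinWheel {α : Type} (G : SimpleGraph α) (H : Set α) (x : α) : Prop :=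
  IsWheel G H x ∧ ∃ p q r : α, p ≠ q ∧ q ≠ r ∧ p ≠ r ∧
    holeNbrs G H x = {p, q, r} ∧ G.Adj p q ∧ G.Adj q r ∧ ¬ G.Adj p r

def IsShortPyramid {α : Type} (G : SimpleGraph α) (H : Set α) (x : α) : Prop :=
  IsWheel G H x ∧ ∃ p q r : α, p ≠ q ∧ q ≠ r ∧ p ≠ r ∧
    holeNbrs G H x = {p, q, r} ∧ G.Adj p q ∧ ¬ G.Adj q r ∧ ¬ G.Adj p r

def IsProperWheel {α : Type} (G : SimpleGraph α) (H : Set α) (x : α) : Prop :=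
  IsWheel G H x ∧ ¬ IsTwinWheel G H x ∧ ¬ IsShortPyramid G H x

/-- `x` is a hub of the induced subgraph `G[W]`. -/
def IsHubIn {α : Type} (G : SimpleGraph α) (W : Set α) (x : α) : Prop :=
  x ∈ W ∧ ∃ H : Set α, H ⊆ W ∧ IsProperWheel G H x

/-- `x` is a hub of `G`: the center of some proper wheel. -/
def IsHub {α : Type} (G : SimpleGraph α) (x : α) : Prop :=
  ∃ H : Set α, IsProperWheel G H x

/-- membership in the class `𝒞` of (C₄, theta, prism, even wheel)-free graphs. -/
def MemC {α : Type} (G : SimpleGraph α) : Prop :=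
  (∀ H : Set α, IsHole G H → H.ncard ≠ 4) ∧ ¬ HasTheta G ∧ ¬ HasPrism G ∧
    (∀ (H : Set α) (x : α), IsWheel G H x → ¬ Even (holeNbrs G H x).ncard)

/-- membership in the class `𝒞ₜ`: graphs in `𝒞` with no clique of size `t`. -/
def MemCt {α : Type} (t : ℕ) (G : SimpleGraph α) : Prop :=
  MemC G ∧ G.CliqueFree t

/-- `G` contains a generalized `k`-pyramid as an induced subgraph. -/
def ContainsGenPyramid {α : Type} (G : SimpleGraph α) (k : ℕ) : Prop :=
  ∃ (nP nQ : ℕ) (P : Fin nP → α) (Q : Fin nQ → α)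
    (m : Fin k → ℕ) (R : ∀ i, Fin (m i) → α) (xI zI : Fin k → ℕ),
    4 ≤ nP + nQ ∧ 1 ≤ nP ∧ 1 ≤ nQ ∧
    IsPathEmb G nP P ∧ IsPathEmb G nQ Q ∧
    (∀ i j, P i ≠ Q j) ∧
    (∀ (i : Fin nP) (j : Fin nQ), G.Adj (P i) (Q j) ↔
      ((i.val = 0 ∧ j.val = 0) ∨ (i.val = nP - 1 ∧ j.val = nQ - 1))) ∧
    (∀ i, 1 ≤ m i) ∧ (∀ i, IsPathEmb G (m i) (R i)) ∧
    (∀ i u j, R i u ≠ P j) ∧ (∀ i u j, R i u ≠ Q j) ∧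
    (∀ i i', i ≠ i' → ∀ u u', R i u ≠ R i' u' ∧ ¬ G.Adj (R i u) (R i' u')) ∧
    (∀ i, 0 < xI i ∧ xI i + 1 < nP - 1) ∧
    (∀ (i : Fin k) (u : Fin (m i)) (j : Fin nP), G.Adj (R i u) (P j) ↔
      (u.val = 0 ∧ (j.val = xI i ∨ j.val = xI i + 1))) ∧
    (∀ i, zI i < nQ) ∧
    (∀ (i : Fin k) (u : Fin (m i)) (j : Fin nQ), G.Adj (R i u) (Q j) ↔
      (u.val = m i - 1 ∧ j.val = zI i)) ∧
    (∀ i i' : Fin k, i < i' → xI i + 1 < xI i') ∧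
    (∀ i i' : Fin k, i ≤ i' → zI i ≤ zI i')

/-- membership in the class `𝒞ₜₜ`: graphs in `𝒞ₜ` with no induced generalized `t`-pyramid. -/
def MemCtt {α : Type} (t : ℕ) (G : SimpleGraph α) : Prop :=
  MemCt t G ∧ ¬ ContainsGenPyramid G t

/-- `(T, χ)` is a tree decomposition of `G`. -/
structure IsTD {α ι : Type} (G : SimpleGraph α) (T : SimpleGraph ι) (χ : ι → Set α) : Prop where
  finite : Finite ι
  isTree : T.IsTree
  memBag : ∀ v : α, ∃ t, v ∈ χ t
  edgeBag : ∀ ⦃u v : α⦄, G.Adj u v → ∃ t, u ∈ χ t ∧ v ∈ χ t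
  subtree : ∀ v : α, (T.induce {t | v ∈ χ t}).Connected

/-- `G` has a tree decomposition of width at most `w`. -/
def TwLE {α : Type} (G : SimpleGraph α) (w : ℕ) : Prop :=
  ∃ (ι : Type) (T : SimpleGraph ι) (χ : ι → Set α),
    IsTD G T χ ∧ ∀ t, (χ t).ncard ≤ w + 1

/-- The treewidth of `G`. -/
noncomputable def treeWidth {α : Type} (G : SimpleGraph α) : ℕ :=
  sInf {w | TwLE G w}

/-- For adjacent `t, t'` in a tree `T`, the vertex set of the component of `T - t`
containing `t'`. -/
def branchSet {ι : Type} (T : SimpleGraph ι) (t t' : ι) : Set ι :=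
  {s | ∀ w : T.Walk s t, t' ∈ w.support}

/-- The vertex set of `G_{t → t'}`: the union of the bags over the component of `T - t`
containing `t'`. -/
def sideSet {α ι : Type} (T : SimpleGraph ι) (χ : ι → Set α) (t t' : ι) : Set α :=
  ⋃ s ∈ branchSet T t t', χ s

/-- `(T, χ)` is a tight tree decomposition of `G`. -/
def TightTD {α ι : Type} (G : SimpleGraph α) (T : SimpleGraph ι) (χ : ι → Set α) : Prop :=
  IsTD G T χ ∧ ∀ ⦃t t' : ι⦄, T.Adj t t' →
    ∃ D, IsCompOf G (sideSet T χ t t' \ χ t) D ∧ setNbhd G D = χ t ∩ χ t'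

/-- `G` admits a clique cutset. -/
def HasCliqueCutset {α : Type} (G : SimpleGraph α) : Prop :=
  ∃ C : Set α, G.IsClique C ∧ ¬ (G.induce (Set.univ \ C)).Preconnected

/-- `G` is chordal: it has no hole. -/
def ChordalG {α : Type} (G : SimpleGraph α) : Prop := ∀ H : Set α, ¬ IsHole G H

/-- `G'` is a minimal chordal completion of `G`. -/
def IsMinChordalCompletion {α : Type} (G G' : SimpleGraph α) : Prop :=
  G ≤ G' ∧ ChordalG G' ∧ ∀ G'', G ≤ G'' → G'' ≤ G' → ChordalG G'' → G'' = G'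

/-- `Ω` is a potential maximal clique of `G` : a maximal clique of some minimal chordal
completion of `G`. -/
def IsPMC {α : Type} (G : SimpleGraph α) (Ω : Set α) : Prop :=
  ∃ G' : SimpleGraph α, IsMinChordalCompletion G G' ∧ G'.IsClique Ω ∧
    ∀ Ω' : Set α, G'.IsClique Ω' → Ω ⊆ Ω' → Ω' = Ω

/-- `(T, χ)` is a structured tree decomposition: every bag is a PMC of `G`. -/
def StructuredTD {α ι : Type} (G : SimpleGraph α) (T : SimpleGraph ι) (χ : ι → Set α) : Prop :=
  IsTD G T χ ∧ ∀ t, IsPMC G (χ t)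

/-- the decomposition has adhesion less than `m`. -/
def AdhLT {α ι : Type} (T : SimpleGraph ι) (χ : ι → Set α) (m : ℕ) : Prop :=
  ∀ ⦃t t' : ι⦄, T.Adj t t' → (χ t ∩ χ t').ncard < m

/-- `fatness χ i` is the number of bags of size `i`. -/
noncomputable def fatness {α ι : Type} (χ : ι → Set α) (i : ℕ) : ℕ :=
  {t : ι | (χ t).ncard = i}.ncard

/-- Lexicographic comparison of fatness vectors `(aₙ, …, a₀)` (larger sizes more
significant). -/
def FatLexLE (f g : ℕ → ℕ) : Prop :=
  (∀ i, f i = g i) ∨ ∃ j, f j < g j ∧ ∀ i, j < i → f i = g i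

/-- `(T, χ)` is an `m`-atomic tree decomposition of `G`: its adhesion is less than `m` and its
fatness is lexicographically minimum among all tree decompositions with adhesion less than `m`. -/
def IsAtomicTD {α ι : Type} (m : ℕ) (G : SimpleGraph α) (T : SimpleGraph ι)
    (χ : ι → Set α) : Prop :=
  IsTD G T χ ∧ AdhLT T χ m ∧
    ∀ (ι' : Type) (T' : SimpleGraph ι') (χ' : ι' → Set α),
      IsTD G T' χ' → AdhLT T' χ' m → FatLexLE (fatness χ) (fatness χ')

/-- Adjacency in the torso at the node `x` of the tree decomposition. -/
def torsoAdj {α ι : Type} (G : SimpleGraph α) (T : SimpleGraph ι) (χ : ι → Set α)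
    (x : ι) (u v : α) : Prop :=
  u ∈ χ x ∧ v ∈ χ x ∧ u ≠ v ∧
    (G.Adj u v ∨ ∃ y, T.Adj x y ∧ u ∈ χ y ∧ v ∈ χ y)

/-- The degree of `u` in the torso at `x`. -/
noncomputable def torsoDeg {α ι : Type} (G : SimpleGraph α) (T : SimpleGraph ι)
    (χ : ι → Set α) (x : ι) (u : α) : ℕ :=
  {v | torsoAdj G T χ x u v}.ncard

/-- `u` and `v` lie in the same component of `G[S]`. -/
def SameComp {α : Type} (G : SimpleGraph α) (S : Set α) (u v : α) : Prop :=
  ∃ (hu : u ∈ S) (hv : v ∈ S), (G.induce S).Reachable ⟨u, hu⟩ ⟨v, hv⟩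

/-- `X` is a minimal separator of `G`. -/
def IsMinimalSeparator {α : Type} (G : SimpleGraph α) (X : Set α) : Prop :=
  ∃ u v : α, u ∉ X ∧ v ∉ X ∧ ¬ SameComp G (Set.univ \ X) u v ∧
    ∀ Y : Set α, Y ⊂ X → SameComp G (Set.univ \ Y) u v
/-- The degree of `v` in `H` (as the cardinality of its neighbor set). -/
noncomputable def degreeSet {α : Type} (H : SimpleGraph α) (v : α) : ℕ :=
  (H.neighborSet v).ncard

/-- `H` is a path (as a graph). -/
def IsPathGraph {α : Type} (H : SimpleGraph α) : Prop :=
  ∃ (n : ℕ) (f : Fin n → α), Function.Bijective f ∧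
    ∀ i j, H.Adj (f i) (f j) ↔ (i.val = j.val + 1 ∨ j.val = i.val + 1)

/-- `H` is a caterpillar: a tree of maximum degree three having a path containing all
branch vertices. -/
def IsCaterpillar {α : Type} (H : SimpleGraph α) : Prop :=
  H.IsTree ∧ (∀ v, degreeSet H v ≤ 3) ∧
    ∃ (n : ℕ) (f : Fin n → α), IsPathEmb H n f ∧
      ∀ v, 2 < degreeSet H v → v ∈ Set.range f

/-- `H` is a subdivided star: a tree with exactly one branch vertex (its root), of degree
at least 3. -/
def IsSubdividedStar {α : Type} (H : SimpleGraph α) : Prop :=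
  H.IsTree ∧ ∃! r, 2 < degreeSet H r

/-- `H` is (isomorphic to) the line graph of a caterpillar. -/
def IsLineGraphOfCaterpillar {α : Type} (H : SimpleGraph α) : Prop :=
  ∃ (β : Type) (C : SimpleGraph β), IsCaterpillar C ∧
    Nonempty (SimpleGraph.Iso H C.lineGraph)

/-- `w` is a simplicial vertex of the induced subgraph `G[W]`. -/
def SimplicialIn {α : Type} (G : SimpleGraph α) (W : Set α) (w : α) : Prop :=
  w ∈ W ∧ G.IsClique {u | u ∈ W ∧ G.Adj w u}

/-- `(p, x)` is an alignment: `p` enumerates an induced path, `x` enumerates the set `X`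
in the order given by the alignment. -/
structure IsAlignment {α : Type} (G : SimpleGraph α) (n : ℕ) (p : Fin n → α)
    (k : ℕ) (x : Fin k → α) : Prop where
  hn : 1 ≤ n
  hk : 2 ≤ k
  path : IsPathEmb G n p
  injx : Function.Injective x
  disj : ∀ i j, x i ≠ p j
  cover : ∀ i, ∃ j, G.Adj (x i) (p j)
  first : ∀ j : Fin n, G.Adj (x ⟨0, by omega⟩) (p j) ↔ j.val = 0
  last : ∀ j : Fin n, G.Adj (x ⟨k - 1, by omega⟩) (p j) ↔ j.val = n - 1
  ordered : ∀ (i i' : Fin k) (j j' : Fin n),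
    i < i' → G.Adj (x i) (p j) → G.Adj (x i') (p j') → j < j'

/-- A wide alignment: every middle vertex of `X` has two non-adjacent neighbors in `P`. -/
def IsWideAlignment {α : Type} (G : SimpleGraph α) (n : ℕ) (p : Fin n → α)
    (k : ℕ) (x : Fin k → α) : Prop :=
  IsAlignment G n p k x ∧ ∀ i : Fin k, 0 < i.val → i.val < k - 1 →
    ∃ j j' : Fin n, j.val + 1 < j'.val ∧ G.Adj (x i) (p j) ∧ G.Adj (x i) (p j')

/-- A spiky alignment: every middle vertex of `X` has a unique neighbor in `P`. -/
def IsSpikyAlignment {α : Type} (G : SimpleGraph α) (n : ℕ) (p : Fin n → α)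
    (k : ℕ) (x : Fin k → α) : Prop :=
  IsAlignment G n p k x ∧ ∀ i : Fin k, 0 < i.val → i.val < k - 1 →
    ∃! j : Fin n, G.Adj (x i) (p j)

/-- A triangular alignment: every middle vertex of `X` has exactly two neighbors in `P`,
and they are adjacent. -/
def IsTriangularAlignment {α : Type} (G : SimpleGraph α) (n : ℕ) (p : Fin n → α)
    (k : ℕ) (x : Fin k → α) : Prop :=
  IsAlignment G n p k x ∧ ∀ i : Fin k, 0 < i.val → i.val < k - 1 →
    ∃ j : Fin n, j.val + 1 < n ∧
      ∀ j' : Fin n, G.Adj (x i) (p j') ↔ (j'.val = j.val ∨ j'.val = j.val + 1)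

/-- `(H, x)` is a spiky connectifier: `H` is an induced caterpillar with spine `p` and legs
`ℓ`, and `x` enumerates `X` in the order given by the connectifier (`x 0` and `x (k-1)`
attached at the ends of the spine, the others to the tips of the legs, in the order in which
the legs attach along the spine). -/
def IsSpikyConnectifier {α : Type} (G : SimpleGraph α) (H : Set α)
    (k : ℕ) (x : Fin k → α) : Prop :=
  ∃ (hk : 2 ≤ k) (n : ℕ) (_ : 2 ≤ n) (p : Fin n → α)
    (m : Fin (k - 2) → ℕ) (ℓ : ∀ i, Fin (m i) → α) (a : Fin (k - 2) → ℕ),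
    IsPathEmb G n p ∧ (∀ i, 1 ≤ m i) ∧ (∀ i, IsPathEmb G (m i) (ℓ i)) ∧
    H = Set.range p ∪ ⋃ i, Set.range (ℓ i) ∧
    Function.Injective x ∧ (∀ i, x i ∉ H) ∧
    (∀ i j j', ℓ i j ≠ p j') ∧
    (∀ i i', i ≠ i' → ∀ j j', ℓ i j ≠ ℓ i' j' ∧ ¬ G.Adj (ℓ i j) (ℓ i' j')) ∧
    (∀ i, 0 < a i ∧ a i < n - 1) ∧
    (∀ i i', i < i' → a i < a i') ∧
    (∀ (i : Fin (k - 2)) (j : Fin (m i)) (j' : Fin n),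
      G.Adj (ℓ i j) (p j') ↔ (j.val = 0 ∧ j'.val = a i)) ∧
    (∀ j : Fin n, G.Adj (x ⟨0, by omega⟩) (p j) ↔ j.val = 0) ∧
    (∀ (i : Fin (k - 2)) (j : Fin (m i)), ¬ G.Adj (x ⟨0, by omega⟩) (ℓ i j)) ∧
    (∀ j : Fin n, G.Adj (x ⟨k - 1, by omega⟩) (p j) ↔ j.val = n - 1) ∧
    (∀ (i : Fin (k - 2)) (j : Fin (m i)), ¬ G.Adj (x ⟨k - 1, by omega⟩) (ℓ i j)) ∧
    (∀ (i : Fin (k - 2)) (j : Fin n),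
      ¬ G.Adj (x ⟨i.val + 1, by have := i.isLt; omega⟩) (p j)) ∧
    (∀ (i i' : Fin (k - 2)) (j : Fin (m i')),
      G.Adj (x ⟨i.val + 1, by have := i.isLt; omega⟩) (ℓ i' j) ↔ (i' = i ∧ j.val = m i' - 1))

/-- `(H, x)` is a triangular connectifier: `H` is the line graph of a caterpillar, with
spine `p` and legs `ℓ` attached along triangles, and `x` enumerates `X` in the order given
by the connectifier. -/
def IsTriangularConnectifier {α : Type} (G : SimpleGraph α) (H : Set α)
    (k : ℕ) (x : Fin k → α) : Prop :=
  ∃ (hk : 2 ≤ k) (n : ℕ) (_ : 2 ≤ n) (p : Fin n → α)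
    (m : Fin (k - 2) → ℕ) (ℓ : ∀ i, Fin (m i) → α) (a : Fin (k - 2) → ℕ),
    IsPathEmb G n p ∧ (∀ i, 1 ≤ m i) ∧ (∀ i, IsPathEmb G (m i) (ℓ i)) ∧
    H = Set.range p ∪ ⋃ i, Set.range (ℓ i) ∧
    Function.Injective x ∧ (∀ i, x i ∉ H) ∧
    (∀ i j j', ℓ i j ≠ p j') ∧
    (∀ i i', i ≠ i' → ∀ j j', ℓ i j ≠ ℓ i' j' ∧ ¬ G.Adj (ℓ i j) (ℓ i' j')) ∧
    (∀ i, a i + 1 ≤ n - 1) ∧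
    (∀ i i', i < i' → a i < a i') ∧
    (∀ (i : Fin (k - 2)) (j : Fin (m i)) (j' : Fin n),
      G.Adj (ℓ i j) (p j') ↔ (j.val = 0 ∧ (j'.val = a i ∨ j'.val = a i + 1))) ∧
    (∀ j : Fin n, G.Adj (x ⟨0, by omega⟩) (p j) ↔ j.val = 0) ∧
    (∀ (i : Fin (k - 2)) (j : Fin (m i)), ¬ G.Adj (x ⟨0, by omega⟩) (ℓ i j)) ∧
    (∀ j : Fin n, G.Adj (x ⟨k - 1, by omega⟩) (p j) ↔ j.val = n - 1) ∧
    (∀ (i : Fin (k - 2)) (j : Fin (m i)), ¬ G.Adj (x ⟨k - 1, by omega⟩) (ℓ i j)) ∧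
    (∀ (i : Fin (k - 2)) (j : Fin n),
      ¬ G.Adj (x ⟨i.val + 1, by have := i.isLt; omega⟩) (p j)) ∧
    (∀ (i i' : Fin (k - 2)) (j : Fin (m i')),
      G.Adj (x ⟨i.val + 1, by have := i.isLt; omega⟩) (ℓ i' j) ↔ (i' = i ∧ j.val = m i' - 1))

/-- `(H, x)` is a stellar connectifier: `H` is an induced subdivided star with root `r` and
legs `ℓ`, and the vertices of `X` are attached to the tips of the legs. -/
def IsStellarConnectifier {α : Type} (G : SimpleGraph α) (H : Set α)
    (k : ℕ) (x : Fin k → α) : Prop :=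
  ∃ (_ : 3 ≤ k) (r : α) (m : Fin k → ℕ) (ℓ : ∀ i, Fin (m i) → α),
    (∀ i, 1 ≤ m i) ∧ (∀ i, IsPathEmb G (m i) (ℓ i)) ∧
    H = {r} ∪ ⋃ i, Set.range (ℓ i) ∧
    Function.Injective x ∧ (∀ i, x i ∉ H) ∧
    (∀ i j, ℓ i j ≠ r) ∧
    (∀ i i', i ≠ i' → ∀ j j', ℓ i j ≠ ℓ i' j' ∧ ¬ G.Adj (ℓ i j) (ℓ i' j')) ∧
    (∀ (i : Fin k) (j : Fin (m i)), G.Adj r (ℓ i j) ↔ j.val = 0) ∧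
    (∀ i, ¬ G.Adj (x i) r) ∧
    (∀ (i i' : Fin k) (j : Fin (m i')),
      G.Adj (x i) (ℓ i' j) ↔ (i' = i ∧ j.val = m i' - 1))

/-- `(H, X)` is a wide alignment (set version). -/
def IsWideAlignSet {α : Type} (G : SimpleGraph α) (H X : Set α) : Prop :=
  ∃ (n k : ℕ) (p : Fin n → α) (e : Fin k → α),
    H = Set.range p ∧ X = Set.range e ∧ IsWideAlignment G n p k e

/-- `(H, X)` is a spiky alignment (set version). -/
def IsSpikyAlignSet {α : Type} (G : SimpleGraph α) (H X : Set α) : Prop :=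
  ∃ (n k : ℕ) (p : Fin n → α) (e : Fin k → α),
    H = Set.range p ∧ X = Set.range e ∧ IsSpikyAlignment G n p k e

/-- `(H, X)` is a triangular alignment (set version). -/
def IsTriAlignSet {α : Type} (G : SimpleGraph α) (H X : Set α) : Prop :=
  ∃ (n k : ℕ) (p : Fin n → α) (e : Fin k → α),
    H = Set.range p ∧ X = Set.range e ∧ IsTriangularAlignment G n p k e

/-- `(H, X)` is a spiky connectifier (set version). -/
def IsSpikyConnSet {α : Type} (G : SimpleGraph α) (H X : Set α) : Prop :=
  ∃ (k : ℕ) (e : Fin k → α), X = Set.range e ∧ IsSpikyConnectifier G H k e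

/-- `(H, X)` is a triangular connectifier (set version). -/
def IsTriConnSet {α : Type} (G : SimpleGraph α) (H X : Set α) : Prop :=
  ∃ (k : ℕ) (e : Fin k → α), X = Set.range e ∧ IsTriangularConnectifier G H k e

/-- `(H, X)` is a stellar connectifier (set version). -/
def IsStellarConnSet {α : Type} (G : SimpleGraph α) (H X : Set α) : Prop :=
  ∃ (k : ℕ) (e : Fin k → α), X = Set.range e ∧ IsStellarConnectifier G H k e

/-- `(H, X)` (with order `e` on `X`) is a consistent alignment or consistent connectifier. -/
def IsConsistentWith {α : Type} (G : SimpleGraph α) (H : Set α)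
    (k : ℕ) (e : Fin k → α) : Prop :=
  (∃ (n : ℕ) (p : Fin n → α), H = Set.range p ∧
    (IsWideAlignment G n p k e ∨ IsSpikyAlignment G n p k e ∨ IsTriangularAlignment G n p k e)) ∨
  IsSpikyConnectifier G H k e ∨ IsTriangularConnectifier G H k e ∨
    IsStellarConnectifier G H k e

/-- `S` is the vertex set of an induced path of `G` from `a` to `b`. -/
def PathOn {α : Type} (G : SimpleGraph α) (a b : α) (S : Set α) : Prop :=
  ∃ (n : ℕ) (f : Fin n → α), IsPathFromTo G n f a b ∧ Set.range f = S

namespace PathOn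

variable {α : Type} {G : SimpleGraph α} {a b c x y : α} {S T : Set α}

theorem single (a : α) : PathOn G a a {a} := by
  refine ⟨1, fun _ => a, ⟨⟨fun i j _ => Subsingleton.elim i j, fun i j => ?_⟩, le_rfl, rfl, rfl⟩, ?_⟩
  · have hi := i.isLt
    have hj := j.isLt
    simp only [SimpleGraph.irrefl, false_iff]
    omega
  · ext v
    simp [eq_comm]

theorem left_mem (h : PathOn G a b S) : a ∈ S := by
  obtain ⟨n, f, ⟨_, _, h0, _⟩, rfl⟩ := h
  exact ⟨_, h0⟩

theorem right_mem (h : PathOn G a b S) : b ∈ S := by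
  obtain ⟨n, f, ⟨_, _, _, h1⟩, rfl⟩ := h
  exact ⟨_, h1⟩

theorem reverse (h : PathOn G a b S) : PathOn G b a S := by
  obtain ⟨n, f, ⟨⟨hinj, hadj⟩, hn, h0, h1⟩, rfl⟩ := h
  refine ⟨n, fun i => f i.rev, ⟨⟨fun i j hij => Fin.rev_injective (hinj hij), fun i j => ?_⟩,
    hn, ?_, ?_⟩, ?_⟩
  · rw [hadj]
    simp only [Fin.val_rev]
    omega
  · rw [← h1]
    exact congrArg f (Fin.ext (by simp only [Fin.val_rev]))
  · rw [← h0]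
    exact congrArg f (Fin.ext (by simp only [Fin.val_rev]; omega))
  · exact Fin.rev_surjective.range_comp f

theorem trans (hS : PathOn G a y S) (hT : PathOn G y b T)
    (hST : ∀ u ∈ S, ∀ v ∈ T, u ≠ y → v ≠ y → u ≠ v ∧ ¬ G.Adj u v) :
    PathOn G a b (S ∪ T) := by
  obtain ⟨n, f, ⟨⟨finj, fadj⟩, hn, f0, f1⟩, rfl⟩ := hS
  obtain ⟨m, g, ⟨⟨ginj, gadj⟩, hm, g0, g1⟩, rfl⟩ := hT
  have cross : ∀ (i : Fin n) (j : Fin m), i.val < n - 1 →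
      f i ≠ g j ∧ (G.Adj (f i) (g j) ↔ i.val + 1 = n - 1 ∧ j.val = 0) := by
    intro i j hi
    have hfi : f i ≠ y := by
      rw [← f1]
      intro h
      have := congrArg Fin.val (finj h)
      simp only at this
      omega
    by_cases hj : j.val = 0
    · have : g j = y := by
        rw [← g0]
        congr 1
        exact Fin.ext hj
      rw [this]
      refine ⟨hfi, ?_⟩
      rw [← f1, fadj]
      simp only
      omega
    · have hgj : g j ≠ y := by
        rw [← g0]
        intro h
        exact hj (congrArg Fin.val (ginj h))
      have h := hST _ ⟨i, rfl⟩ _ ⟨j, rfl⟩ hfi hgj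
      exact ⟨h.1, ⟨fun h' => absurd h' h.2, fun h' => absurd h'.2 hj⟩⟩
  let h : Fin (n + m - 1) → α := fun i =>
    if hi : i.val < n - 1 then f ⟨i.val, by omega⟩ else g ⟨i.val - (n - 1), by omega⟩
  have hl : ∀ (i : Fin (n + m - 1)) (hi : i.val < n - 1), h i = f ⟨i.val, by omega⟩ :=
    fun i hi => dif_pos hi
  have hr : ∀ (i : Fin (n + m - 1)) (hi : ¬ i.val < n - 1),
      h i = g ⟨i.val - (n - 1), by omega⟩ := fun i hi => dif_neg hi
  refine ⟨n + m - 1, h, ⟨⟨?_, ?_⟩, by omega, ?_, ?_⟩, ?_⟩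
  · intro i j hij
    by_cases hi : i.val < n - 1 <;> by_cases hj : j.val < n - 1
    · rw [hl i hi, hl j hj] at hij
      have := congrArg Fin.val (finj hij)
      exact Fin.ext this
    · rw [hl i hi, hr j hj] at hij
      exact absurd hij (cross _ _ hi).1
    · rw [hr i hi, hl j hj] at hij
      exact absurd hij.symm (cross _ _ hj).1
    · rw [hr i hi, hr j hj] at hij
      have := congrArg Fin.val (ginj hij)
      simp only at this
      exact Fin.ext (by omega)
  · intro i j
    by_cases hi : i.val < n - 1 <;> by_cases hj : j.val < n - 1
    · rw [hl i hi, hl j hj, fadj]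
    · rw [hl i hi, hr j hj, (cross _ _ hi).2]
      simp only
      omega
    · rw [hr i hi, hl j hj, G.adj_comm, (cross _ _ hj).2]
      simp only
      omega
    · rw [hr i hi, hr j hj, gadj]
      simp only
      omega
  · by_cases h0 : 0 < n - 1
    · rw [hl _ h0, f0]
    · rw [hr _ h0, ← f0]
      simp only [Nat.zero_sub]
      rw [g0, ← f1]
      congr 2
      omega
  · rw [hr _ (by simp only; omega), ← g1]
    congr 2
    simp only
    omega
  · ext v
    constructor
    · rintro ⟨i, rfl⟩
      by_cases hi : i.val < n - 1
      · rw [hl i hi]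
        exact Or.inl ⟨_, rfl⟩
      · rw [hr i hi]
        exact Or.inr ⟨_, rfl⟩
    · rintro (⟨i, rfl⟩ | ⟨j, rfl⟩)
      · by_cases hi : i.val < n - 1
        · exact ⟨⟨i.val, by omega⟩, hl _ hi⟩
        · refine ⟨⟨n - 1, by omega⟩, ?_⟩
          rw [hr _ (by simp only; omega)]
          simp only [Nat.sub_self]
          rw [g0, ← f1]
          congr 1
          ext
          simp only
          omega
      · refine ⟨⟨n - 1 + j.val, by omega⟩, ?_⟩
        rw [hr _ (by simp only; omega)]
        congr 1
        ext
        simp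

theorem edge (h : G.Adj a b) : PathOn G a b {a, b} := by
  refine ⟨2, ![a, b], ⟨⟨?_, ?_⟩, by omega, rfl, rfl⟩, ?_⟩
  · intro i j
    fin_cases i <;> fin_cases j <;> simp [h.ne, h.ne']
  · intro i j
    fin_cases i <;> fin_cases j <;> simp [h, h.symm]
  · ext v
    simp [eq_comm, or_comm]

/-- Appending a vertex to an induced path. -/
theorem extend (h : PathOn G a b S) (hxS : x ∉ S) (hx : ∀ v ∈ S, G.Adj x v ↔ v = b) :
    PathOn G a x (insert x S) := by
  have hbx : G.Adj b x := ((hx b h.right_mem).2 rfl).symm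
  have := h.trans (edge hbx) (by
    rintro u hu v (rfl | rfl) hub hvb
    · exact absurd rfl hvb
    · exact ⟨fun e => hxS (e ▸ hu), fun e => hub ((hx u hu).1 e.symm)⟩)
  convert this using 1
  ext v
  have := h.right_mem
  simp only [Set.mem_insert_iff, Set.mem_union, Set.mem_singleton_iff]
  constructor
  · tauto
  · rintro (h | rfl | h) <;> tauto

/-- The segment of an induced path between two of its vertices. -/
theorem segment {n : ℕ} {p : Fin n → α} (hp : IsPathEmb G n p) (i j : Fin n) (hij : i ≤ j) :
    PathOn G (p i) (p j) {v | ∃ l, i ≤ l ∧ l ≤ j ∧ p l = v} := by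
  have hij' : i.val ≤ j.val := hij
  refine ⟨j.val - i.val + 1, fun l => p ⟨i.val + l.val, by omega⟩, ⟨⟨?_, ?_⟩, by omega, ?_, ?_⟩, ?_⟩
  · intro l l' h
    have := congrArg Fin.val (hp.1 h)
    simp only at this
    exact Fin.ext (by omega)
  · intro l l'
    rw [hp.2]
    simp only
    omega
  · rfl
  · exact congrArg p (Fin.ext (by simp only; omega))
  · ext v
    constructor
    · rintro ⟨l, rfl⟩
      refine ⟨_, ?_, ?_, rfl⟩
      · change i.val ≤ i.val + l.val
        omega
      · change i.val + l.val ≤ j.val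
        omega
    · rintro ⟨l, h1, h2, rfl⟩
      have h1 : i.val ≤ l.val := h1
      have h2 : l.val ≤ j.val := h2
      refine ⟨⟨l.val - i.val, by omega⟩, ?_⟩
      simp only
      congr 1
      ext
      simp only
      omega

theorem ofEmb {n : ℕ} {p : Fin n → α} (hp : IsPathEmb G n p) (hn : 1 ≤ n) :
    PathOn G (p ⟨0, hn⟩) (p ⟨n - 1, by omega⟩) (Set.range p) :=
  ⟨n, p, ⟨hp, hn, rfl, rfl⟩, rfl⟩

/-- An induced path together with a vertex adjacent to exactly its two ends is a hole. -/
theorem isHole (h : PathOn G a b S) (hab : a ≠ b) (hadj : ¬ G.Adj a b) (hxS : x ∉ S)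
    (hx : ∀ v ∈ S, G.Adj x v ↔ v = a ∨ v = b) : IsHole G (insert x S) := by
  obtain ⟨n, f, ⟨⟨finj, fadj⟩, hn, f0, f1⟩, rfl⟩ := h
  have hn3 : 3 ≤ n := by
    by_contra hlt
    have : n = 1 ∨ n = 2 := by omega
    rcases this with rfl | rfl
    · exact hab (f0.symm.trans f1)
    · apply hadj
      rw [← f0, ← f1, fadj]
      simp
  have hxa : ∀ i : Fin n, G.Adj x (f i) ↔ i.val = 0 ∨ i.val = n - 1 := by
    intro i
    rw [hx _ ⟨i, rfl⟩, ← f0, ← f1, finj.eq_iff, finj.eq_iff, Fin.ext_iff, Fin.ext_iff]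
  let g : Fin (n + 1) → α := Fin.cons x f
  refine ⟨n + 1, g, by omega, ⟨?_, ?_⟩, ?_⟩
  · exact Fin.cons_injective_iff.2 ⟨hxS, finj⟩
  · have key : ∀ i j : Fin (n + 1), G.Adj (g i) (g j) ↔ (i = j + 1 ∨ j = i + 1) := by
      have hadd : ∀ i j : Fin (n + 1), i = j + 1 ↔
          (j.val = n ∧ i.val = 0) ∨ (j.val < n ∧ i.val = j.val + 1) := by
        intro i j
        rw [Fin.ext_iff, Fin.val_add_one]
        have : j = Fin.last n ↔ j.val = n := by rw [Fin.ext_iff]; rfl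
        split_ifs <;> omega
      intro i j
      rw [hadd, hadd]
      refine Fin.cases ?_ (fun i => ?_) i <;> refine Fin.cases ?_ (fun j => ?_) j
      · simp [g]
        omega
      · simp only [g, Fin.cons_zero, Fin.cons_succ, Fin.val_succ, Fin.val_zero, hxa, and_true]
        omega
      · simp only [g, Fin.cons_zero, Fin.cons_succ, Fin.val_succ, Fin.val_zero, G.adj_comm _ x, hxa, and_true]
        omega
      · simp only [g, Fin.cons_succ, Fin.val_succ, fadj]
        omega
    exact key
  · exact Fin.range_cons x f

end PathOn

theorem hasTheta_of_pathOn {α : Type} {G : SimpleGraph α} {a b : α} {S : Fin 3 → Set α}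
    (hab : a ≠ b) (hadj : ¬ G.Adj a b) (hS : ∀ i, PathOn G a b (S i))
    (cross : ∀ i j, i ≠ j → ∀ u ∈ S i, ∀ v ∈ S j, u ≠ a → u ≠ b → v ≠ a → v ≠ b →
      u ≠ v ∧ ¬ G.Adj u v) : HasTheta G := by
  choose n f hf hr using hS
  have hint : ∀ (i : Fin 3) (u : Fin (n i)), 0 < u.val → u.val < n i - 1 →
      f i u ≠ a ∧ f i u ≠ b := by
    intro i u h0 h1
    obtain ⟨⟨finj, -⟩, hn, f0, f1⟩ := hf i
    rw [← f0, ← f1, finj.ne_iff, finj.ne_iff, Ne, Fin.ext_iff, Ne, Fin.ext_iff]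
    simp only
    omega
  refine ⟨a, b, n, f, hab, hadj, fun i => ?_, hf, fun i j hij u v hu hu' hv hv' => ?_⟩
  · obtain ⟨⟨-, fadj⟩, hn, f0, f1⟩ := hf i
    by_contra hlt
    have : n i = 1 ∨ n i = 2 := by omega
    rcases this with h | h
    · apply hab
      rw [← f0, ← f1]
      congr 2
      omega
    · apply hadj
      rw [← f0, ← f1, fadj]
      simp only
      omega
  · exact cross i j hij _ (hr i ▸ ⟨u, rfl⟩) _ (hr j ▸ ⟨v, rfl⟩) (hint i u hu hu').1
      (hint i u hu hu').2 (hint j v hv hv').1 (hint j v hv hv').2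

theorem hasPrism_of_pathOn {α : Type} {G : SimpleGraph α} {a b : Fin 3 → α}
    {S : Fin 3 → Set α} (hab : ∀ i, a i ≠ b i) (hS : ∀ i, PathOn G (a i) (b i) (S i))
    (cross : ∀ i j, i ≠ j → ∀ u ∈ S i, ∀ v ∈ S j,
      u ≠ v ∧ (G.Adj u v ↔ (u = a i ∧ v = a j) ∨ (u = b i ∧ v = b j))) : HasPrism G := by
  choose n f hf hr using hS
  refine ⟨n, f, fun i => ?_, fun i => (hf i).1, fun i j hij u v => ?_, fun i j hij u v => ?_⟩
  · obtain ⟨-, hn, f0, f1⟩ := hf i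
    by_contra hlt
    apply hab i
    rw [← f0, ← f1]
    congr 2
    omega
  · exact (cross i j hij _ (hr i ▸ ⟨u, rfl⟩) _ (hr j ▸ ⟨v, rfl⟩)).1
  · rw [(cross i j hij _ (hr i ▸ ⟨u, rfl⟩) _ (hr j ▸ ⟨v, rfl⟩)).2]
    obtain ⟨⟨finj, -⟩, hn, f0, f1⟩ := hf i
    obtain ⟨⟨ginj, -⟩, hm, g0, g1⟩ := hf j
    rw [← f0, ← f1, ← g0, ← g1, finj.eq_iff, finj.eq_iff, ginj.eq_iff, ginj.eq_iff]
    simp only [Fin.ext_iff]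

theorem forall_ne_fin_three {R : Fin 3 → Fin 3 → Prop} (symm : ∀ i j, R i j → R j i)
    (h01 : R 0 1) (h02 : R 0 2) (h12 : R 1 2) : ∀ i j, i ≠ j → R i j := by
  intro i j hij
  fin_cases i <;> fin_cases j <;> first | exact absurd rfl hij | assumption | (apply symm; assumption)

/-- Three induced paths starting at `c`, with pairwise anticomplete remainders, whose other ends
are `y 0`, `y 1`, `y 2` and which otherwise stay in `A ∪ {c}`. -/
structure ThetaHalf {α : Type} (G : SimpleGraph α) (A : Set α) (y : Fin 3 → α) (c : α)
    (S : Fin 3 → Set α) : Prop where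
  path : ∀ i, PathOn G c (y i) (S i)
  sub : ∀ i, ∀ u ∈ S i, u ∈ A ∨ u = y i ∨ u = c
  cross : ∀ i j, i ≠ j → ∀ u ∈ S i, ∀ v ∈ S j, u ≠ c → v ≠ c → u ≠ v ∧ ¬ G.Adj u v

/-- Three disjoint induced paths from the triangle `t` to `y 0`, `y 1`, `y 2`, with no other
edges between them, which otherwise stay in `A`. -/
structure PrismHalf {α : Type} (G : SimpleGraph α) (A : Set α) (y t : Fin 3 → α)
    (S : Fin 3 → Set α) : Prop where
  path : ∀ i, PathOn G (t i) (y i) (S i)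
  sub : ∀ i, ∀ u ∈ S i, u ∈ A ∨ u = y i
  cross : ∀ i j, i ≠ j → ∀ u ∈ S i, ∀ v ∈ S j, u ≠ v ∧ (G.Adj u v ↔ u = t i ∧ v = t j)

theorem Anticomplete.symm {α : Type} {G : SimpleGraph α} {A B : Set α}
    (h : Anticomplete G A B) : Anticomplete G B A :=
  fun b hb a ha hab => h a ha b hb hab.symm

theorem ThetaHalf.hasTheta {α : Type} {G : SimpleGraph α} {A B : Set α} {y : Fin 3 → α}
    {c d : α} {S T : Fin 3 → Set α} (hS : ThetaHalf G A y c S) (hT : ThetaHalf G B y d T)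
    (hAB : Disjoint A B) (hanti : Anticomplete G A B) (hyB : ∀ i, y i ∉ B)
    (hd : d ∈ B) (hc : c ∈ A ∨ ∃ i, c = y i) (hcd : c ≠ d) (hadj : ¬ G.Adj c d) :
    HasTheta G := by
  have hTsub : ∀ i, ∀ v ∈ T i, v ∈ B ∨ v = y i := by
    intro i v hv
    rcases hT.sub i v hv with h | h | rfl
    exacts [Or.inl h, Or.inr h, Or.inl hd]
  have hyd : ∀ i, y i ≠ d := fun i h => hyB i (h ▸ hd)
  have hne : ∀ u ∈ A, ∀ v ∈ B, u ≠ v ∧ ¬ G.Adj u v := fun u hu v hv =>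
    ⟨fun h => Set.disjoint_left.1 hAB hu (h ▸ hv), hanti u hu v hv⟩
  have hST : ∀ i j, i ≠ j → ∀ u ∈ S i, ∀ v ∈ T j, u ≠ c → v ≠ c → v ≠ d →
      u ≠ v ∧ ¬ G.Adj u v := by
    intro i j hij u hu v hv huc hvc hvd
    rcases hS.sub i u hu with hA | rfl | rfl
    · rcases hTsub j v hv with hB | rfl
      · exact hne u hA v hB
      · exact hS.cross i j hij u hu _ (hS.path j).right_mem huc hvc
    · exact hT.cross i j hij _ (hT.path i).right_mem v hv (hyd i) hvd
    · exact absurd rfl huc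
  refine hasTheta_of_pathOn (S := fun i => S i ∪ T i) hcd hadj
    (fun i => (hS.path i).trans (hT.path i).reverse ?_) ?_
  · intro u hu v hv huy hvy
    have hvB : v ∈ B := (hTsub i v hv).resolve_right hvy
    have hcase : u ∈ A ∨ u = c := by
      rcases hS.sub i u hu with h | h | h
      exacts [Or.inl h, absurd h huy, Or.inr h]
    rcases hcase with huA | rfl
    · exact hne u huA v hvB
    · rcases hc with hcA | ⟨l, rfl⟩
      · exact hne _ hcA v hvB
      · by_cases hvd : v = d
        · exact hvd ▸ ⟨hcd, hadj⟩
        · exact hT.cross l i (fun h => huy (h ▸ rfl)) _ (hT.path l).right_mem v hv (hyd l) hvd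
  · rintro i j hij u (hu | hu) v (hv | hv) huc hud hvc hvd
    · exact hS.cross i j hij u hu v hv huc hvc
    · exact hST i j hij u hu v hv huc hvc hvd
    · have := hST j i hij.symm v hv u hu hvc huc hud
      exact ⟨this.1.symm, fun h => this.2 h.symm⟩
    · exact hT.cross i j hij u hu v hv hud hvd

theorem PrismHalf.hasPrism {α : Type} {G : SimpleGraph α} {A B : Set α} {y t t' : Fin 3 → α}
    {S T : Fin 3 → Set α} (hS : PrismHalf G A y t S) (hT : PrismHalf G B y t' T)
    (hAB : Disjoint A B) (hanti : Anticomplete G A B) (hyB : ∀ i, y i ∉ B)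
    (ht' : ∀ i, t' i ∈ B) : HasPrism G := by
  have hne : ∀ u ∈ A, ∀ v ∈ B, u ≠ v ∧ ¬ G.Adj u v := fun u hu v hv =>
    ⟨fun h => Set.disjoint_left.1 hAB hu (h ▸ hv), hanti u hu v hv⟩
  have hST : ∀ i j, i ≠ j → ∀ u ∈ S i, ∀ v ∈ T j,
      u ≠ v ∧ (G.Adj u v ↔ (u = t i ∧ v = t j) ∨ (u = t' i ∧ v = t' j)) := by
    intro i j hij u hu v hv
    have hl : (u = t i ∧ v = t j) → G.Adj u v := by
      rintro ⟨rfl, rfl⟩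
      exact (hS.cross i j hij _ (hS.path i).left_mem _ (hS.path j).left_mem).2.2 ⟨rfl, rfl⟩
    have hr : (u = t' i ∧ v = t' j) → G.Adj u v := by
      rintro ⟨rfl, rfl⟩
      exact (hT.cross i j hij _ (hT.path i).left_mem _ (hT.path j).left_mem).2.2 ⟨rfl, rfl⟩
    have hor := fun h => Or.elim h hl hr
    rcases hS.sub i u hu with hA | rfl
    · rcases hT.sub j v hv with hB | rfl
      · exact ⟨(hne u hA v hB).1, fun h => absurd h (hne u hA v hB).2, hor⟩
      · have := hS.cross i j hij u hu _ (hS.path j).right_mem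
        exact ⟨this.1, fun h => Or.inl (this.2.1 h), hor⟩
    · have := hT.cross i j hij _ (hT.path i).right_mem v hv
      exact ⟨this.1, fun h => Or.inr (this.2.1 h), hor⟩
  refine hasPrism_of_pathOn (a := t) (b := t') (S := fun i => S i ∪ T i) ?_
    (fun i => (hS.path i).trans (hT.path i).reverse ?_) ?_
  · intro i h
    rcases hS.sub i _ (hS.path i).left_mem with hA | hy
    · exact (hne _ hA _ (ht' i)).1 h
    · exact hyB i (hy ▸ h ▸ ht' i)
  · intro u hu v hv huy hvy
    exact hne u ((hS.sub i u hu).resolve_right huy) v ((hT.sub i v hv).resolve_right hvy)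
  · rintro i j hij u (hu | hu) v (hv | hv)
    · obtain ⟨h1, h2⟩ := hS.cross i j hij u hu v hv
      refine ⟨h1, fun h => Or.inl (h2.1 h), ?_⟩
      rintro (h | ⟨rfl, rfl⟩)
      · exact h2.2 h
      · exact (hT.cross i j hij _ (hT.path i).left_mem _ (hT.path j).left_mem).2.2 ⟨rfl, rfl⟩
    · exact hST i j hij u hu v hv
    · obtain ⟨h1, h2⟩ := hST j i hij.symm v hv u hu
      refine ⟨h1.symm, ?_⟩
      rw [G.adj_comm, h2]
      tauto
    · obtain ⟨h1, h2⟩ := hT.cross i j hij u hu v hv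
      refine ⟨h1, fun h => Or.inr (h2.1 h), ?_⟩
      rintro (⟨rfl, rfl⟩ | h)
      · exact (hS.cross i j hij _ (hS.path i).left_mem _ (hS.path j).left_mem).2.2 ⟨rfl, rfl⟩
      · exact h2.2 h

/-- A vertex attached at the start of an induced path, seen from the `j`-th vertex. -/
theorem PathOn.down {α : Type} {G : SimpleGraph α} {n : ℕ} {p : Fin n → α} {x : α}
    (hp : IsPathEmb G n p) (hxp : ∀ l, x ≠ p l) (hx : ∀ l, G.Adj x (p l) ↔ l.val = 0)
    (j : Fin n) : PathOn G (p j) x (insert x {v | ∃ l, l ≤ j ∧ p l = v}) := by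
  have hn : 0 < n := by have := j.isLt; omega
  have h := (PathOn.segment hp ⟨0, hn⟩ j (Nat.zero_le _)).reverse
  have hset : {v | ∃ l, (⟨0, hn⟩ : Fin n) ≤ l ∧ l ≤ j ∧ p l = v} = {v | ∃ l, l ≤ j ∧ p l = v} := by
    ext v
    exact ⟨fun ⟨l, _, h⟩ => ⟨l, h⟩, fun ⟨l, h⟩ => ⟨l, Nat.zero_le _, h⟩⟩
  rw [hset] at h
  refine h.extend ?_ ?_
  · rintro ⟨l, -, hl⟩
    exact hxp l hl.symm
  · rintro v ⟨l, -, rfl⟩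
    rw [hx, hp.1.eq_iff, Fin.ext_iff]

/-- A vertex attached at the end of an induced path, seen from the `j`-th vertex. -/
theorem PathOn.up {α : Type} {G : SimpleGraph α} {n : ℕ} {p : Fin n → α} {x : α}
    (hp : IsPathEmb G n p) (hxp : ∀ l, x ≠ p l) (hx : ∀ l, G.Adj x (p l) ↔ l.val = n - 1)
    (j : Fin n) : PathOn G (p j) x (insert x {v | ∃ l, j ≤ l ∧ p l = v}) := by
  have hj := j.isLt
  have hle : ∀ l : Fin n, l ≤ ⟨n - 1, by omega⟩ := fun l => by
    change l.val ≤ n - 1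
    omega
  have h := PathOn.segment hp j ⟨n - 1, by omega⟩ (hle j)
  have hset : {v | ∃ l, j ≤ l ∧ l ≤ (⟨n - 1, by omega⟩ : Fin n) ∧ p l = v} =
      {v | ∃ l, j ≤ l ∧ p l = v} := by
    ext v
    exact ⟨fun ⟨l, h, _, h'⟩ => ⟨l, h, h'⟩, fun ⟨l, h, h'⟩ => ⟨l, h, hle l, h'⟩⟩
  rw [hset] at h
  refine h.extend ?_ ?_
  · rintro ⟨l, -, hl⟩
    exact hxp l hl.symm
  · rintro v ⟨l, -, rfl⟩
    rw [hx, hp.1.eq_iff, Fin.ext_iff]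

/-- An induced path `p` in `A` whose ends are attached to `x₀` and `x₂`, with a further induced
path `L` from `t` to `x₁` whose only edges to `p` go from `t` to the vertices with indices
`j` and `j'`. -/
structure SpineWithLeg {α : Type} (G : SimpleGraph α) (A : Set α) {n : ℕ} (p : Fin n → α)
    (j j' : Fin n) (x₀ x₁ x₂ t : α) (L : Set α) : Prop where
  path : IsPathEmb G n p
  mem : ∀ l, p l ∈ A
  notMem₀ : x₀ ∉ A
  notMem₂ : x₂ ∉ A
  adj₀ : ∀ l, G.Adj x₀ (p l) ↔ l.val = 0
  adj₂ : ∀ l, G.Adj x₂ (p l) ↔ l.val = n - 1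
  ne : x₀ ≠ x₂
  not_adj : ¬ G.Adj x₀ x₂
  leg : PathOn G t x₁ L
  leg_mem : ∀ v ∈ L, v ∈ A ∨ v = x₁
  leg_ne : ∀ v ∈ L, ∀ l, v ≠ p l
  leg_adj : ∀ v ∈ L, ∀ l, G.Adj v (p l) ↔ v = t ∧ (l = j ∨ l = j')
  leg₀ : ∀ v ∈ L, v ≠ x₀ ∧ ¬ G.Adj v x₀
  leg₂ : ∀ v ∈ L, v ≠ x₂ ∧ ¬ G.Adj v x₂

namespace SpineWithLeg

variable {α : Type} {G : SimpleGraph α} {A : Set α} {n : ℕ} {p : Fin n → α}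
  {j j' : Fin n} {x₀ x₁ x₂ t : α} {L : Set α}

theorem ne₀ (h : SpineWithLeg G A p j j' x₀ x₁ x₂ t L) (l : Fin n) : x₀ ≠ p l :=
  fun e => h.notMem₀ (e ▸ h.mem l)

theorem ne₂ (h : SpineWithLeg G A p j j' x₀ x₁ x₂ t L) (l : Fin n) : x₂ ≠ p l :=
  fun e => h.notMem₂ (e ▸ h.mem l)

theorem thetaHalf (h : SpineWithLeg G A p j j x₀ x₁ x₂ t L) :
    ∃ S, ThetaHalf G A ![x₀, x₁, x₂] (p j) S := by
  refine ⟨![insert x₀ {v | ∃ l, l ≤ j ∧ p l = v}, insert (p j) L,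
    insert x₂ {v | ∃ l, j ≤ l ∧ p l = v}], ?_, ?_, ?_⟩
  · intro i
    fin_cases i
    · exact PathOn.down h.path h.ne₀ h.adj₀ j
    · refine (h.leg.reverse.extend (fun hj => h.leg_ne _ hj j rfl) fun v hv => ?_).reverse
      rw [G.adj_comm, h.leg_adj v hv]
      simp
    · exact PathOn.up h.path h.ne₂ h.adj₂ j
  · intro i
    fin_cases i
    · rintro u (rfl | ⟨l, -, rfl⟩)
      exacts [Or.inr (Or.inl rfl), Or.inl (h.mem l)]
    · rintro u (rfl | hu)
      · exact Or.inr (Or.inr rfl)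
      · exact (h.leg_mem u hu).imp_right Or.inl
    · rintro u (rfl | ⟨l, -, rfl⟩)
      exacts [Or.inr (Or.inl rfl), Or.inl (h.mem l)]
  · refine forall_ne_fin_three ?_ ?_ ?_ ?_
    · intro i j hij u hu v hv huc hvc
      have := hij v hv u hu hvc huc
      exact ⟨this.1.symm, fun e => this.2 e.symm⟩
    · rintro u (rfl | ⟨l, hl, rfl⟩) v (rfl | hv) huc hvc
      · exact absurd rfl hvc
      · exact ⟨(h.leg₀ v hv).1.symm, fun e => (h.leg₀ v hv).2 e.symm⟩
      · exact absurd rfl hvc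
      · refine ⟨(h.leg_ne v hv l).symm, fun e => huc ?_⟩
        have := ((h.leg_adj v hv l).1 e.symm).2
        rw [or_self] at this
        rw [this]
    · rintro u (rfl | ⟨l, hl, rfl⟩) v (rfl | ⟨l', hl', rfl⟩) huc hvc
      · exact ⟨h.ne, h.not_adj⟩
      · refine ⟨h.ne₀ l', fun e => hvc ?_⟩
        have := (h.adj₀ l').1 e
        congr 1
        have hl' : j.val ≤ l'.val := hl'
        exact Fin.ext (by omega)
      · refine ⟨(h.ne₂ l).symm, fun e => huc ?_⟩
        have := (h.adj₂ l).1 e.symm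
        congr 1
        have hl : l.val ≤ j.val := hl
        exact Fin.ext (by omega)
      · have hl : l.val ≤ j.val := hl
        have hl' : j.val ≤ l'.val := hl'
        rw [h.path.1.ne_iff] at huc hvc ⊢
        rw [h.path.2]
        rw [Ne, Fin.ext_iff] at huc hvc ⊢
        omega
    · rintro u (rfl | hu) v (rfl | ⟨l, hl, rfl⟩) huc hvc
      · exact absurd rfl huc
      · exact absurd rfl huc
      · exact h.leg₂ u hu
      · refine ⟨h.leg_ne u hu l, fun e => hvc ?_⟩
        have := ((h.leg_adj u hu l).1 e).2
        rw [or_self] at this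
        rw [this]

theorem prismHalf (h : SpineWithLeg G A p j j' x₀ x₁ x₂ t L) (hj : j'.val = j.val + 1) :
    ∃ S, PrismHalf G A ![x₀, x₁, x₂] ![p j, t, p j'] S := by
  refine ⟨![insert x₀ {v | ∃ l, l ≤ j ∧ p l = v}, L,
    insert x₂ {v | ∃ l, j' ≤ l ∧ p l = v}], ?_, ?_, ?_⟩
  · intro i
    fin_cases i
    · exact PathOn.down h.path h.ne₀ h.adj₀ j
    · exact h.leg
    · exact PathOn.up h.path h.ne₂ h.adj₂ j'
  · intro i
    fin_cases i
    · rintro u (rfl | ⟨l, -, rfl⟩)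
      exacts [Or.inr rfl, Or.inl (h.mem l)]
    · exact h.leg_mem
    · rintro u (rfl | ⟨l, -, rfl⟩)
      exacts [Or.inr rfl, Or.inl (h.mem l)]
  · have hinj := h.path.1
    refine forall_ne_fin_three ?_ ?_ ?_ ?_
    · intro i j hij u hu v hv
      have := hij v hv u hu
      refine ⟨this.1.symm, ?_⟩
      rw [G.adj_comm, this.2, and_comm]
    · rintro u (rfl | ⟨l, hl, rfl⟩) v hv
      · exact ⟨(h.leg₀ v hv).1.symm, fun e => absurd e.symm (h.leg₀ v hv).2,
          fun e => absurd e.1 (h.ne₀ j)⟩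
      · refine ⟨(h.leg_ne v hv l).symm, ?_⟩
        have hl : l.val ≤ j.val := hl
        rw [G.adj_comm, h.leg_adj v hv]
        change _ ↔ p l = p j ∧ v = t
        rw [hinj.eq_iff, Fin.ext_iff, Fin.ext_iff, and_comm]
        have : (l.val = j.val ∨ l.val = j'.val) ↔ l.val = j.val := by omega
        rw [this]
    · rintro u (rfl | ⟨l, hl, rfl⟩) v (rfl | ⟨l', hl', rfl⟩)
      · exact ⟨h.ne, fun e => absurd e h.not_adj, fun e => absurd e.1 (h.ne₀ j)⟩
      · refine ⟨h.ne₀ l', fun e => ?_, fun e => absurd e.1 (h.ne₀ j)⟩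
        have := (h.adj₀ l').1 e
        have hl' : j'.val ≤ l'.val := hl'
        omega
      · refine ⟨(h.ne₂ l).symm, fun e => ?_, fun e => absurd e.2 (h.ne₂ j')⟩
        have := (h.adj₂ l).1 e.symm
        have hl : l.val ≤ j.val := hl
        omega
      · have hl : l.val ≤ j.val := hl
        have hl' : j'.val ≤ l'.val := hl'
        change _ ∧ (_ ↔ p l = p j ∧ p l' = p j')
        rw [hinj.ne_iff, h.path.2, hinj.eq_iff, hinj.eq_iff, Ne, Fin.ext_iff, Fin.ext_iff,
          Fin.ext_iff]
        omega
    · rintro u hu v (rfl | ⟨l, hl, rfl⟩)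
      · exact ⟨(h.leg₂ u hu).1, fun e => absurd e (h.leg₂ u hu).2, fun e => absurd e.2 (h.ne₂ j')⟩
      · refine ⟨h.leg_ne u hu l, ?_⟩
        have hl : j'.val ≤ l.val := hl
        rw [h.leg_adj u hu]
        change _ ↔ u = t ∧ p l = p j'
        rw [hinj.eq_iff, Fin.ext_iff, Fin.ext_iff]
        have : (l.val = j.val ∨ l.val = j'.val) ↔ l.val = j'.val := by omega
        rw [this]

end SpineWithLeg

/-- The two extreme vertices of an enumeration together with the second one. -/
def sampleTriple {α : Type} {k : ℕ} (hk : 3 ≤ k) (e : Fin k → α) : Fin 3 → α :=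
  ![e ⟨0, by omega⟩, e ⟨1, by omega⟩, e ⟨k - 1, by omega⟩]

theorem sampleTriple_eq {α : Type} {k : ℕ} (hk : 3 ≤ k) (e : Fin k → α) :
    ∃ σ : Fin 3 → Fin k, Function.Injective σ ∧ sampleTriple hk e = fun i => e (σ i) := by
  refine ⟨![⟨0, by omega⟩, ⟨1, by omega⟩, ⟨k - 1, by omega⟩], ?_, ?_⟩
  · intro i j
    fin_cases i <;> fin_cases j <;> simp [Fin.ext_iff] <;> omega
  · funext i
    fin_cases i <;> rfl

/-- Every vertex of `X` has at most one neighbor in `A`. -/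
def UniqueNbrIn {α : Type} (G : SimpleGraph α) (A X : Set α) : Prop :=
  ∀ x ∈ X, ∀ u ∈ A, ∀ v ∈ A, G.Adj x u → G.Adj x v → u = v

theorem UniqueNbrIn.not_isWideAlignSet {α : Type} {G : SimpleGraph α} {A X : Set α}
    (hX : 3 ≤ X.ncard) (h : UniqueNbrIn G A X) : ¬ IsWideAlignSet G A X := by
  rintro ⟨n, k, p, e, rfl, rfl, hal, hw⟩
  have hk : 3 ≤ k := by
    have := Set.ncard_range_of_injective hal.injx
    rw [this] at hX
    simpa using hX
  obtain ⟨j, j', hj, h1, h2⟩ := hw ⟨1, by omega⟩ (by simp) (by simp only; omega)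
  have := hal.path.1 (h _ ⟨_, rfl⟩ _ ⟨j, rfl⟩ _ ⟨j', rfl⟩ h1 h2)
  subst this
  omega

theorem UniqueNbrIn.not_isTriAlignSet {α : Type} {G : SimpleGraph α} {A X : Set α}
    (hX : 3 ≤ X.ncard) (h : UniqueNbrIn G A X) : ¬ IsTriAlignSet G A X := by
  rintro ⟨n, k, p, e, rfl, rfl, hal, hw⟩
  have hk : 3 ≤ k := by
    have := Set.ncard_range_of_injective hal.injx
    rw [this] at hX
    simpa using hX
  obtain ⟨j, hj, h1⟩ := hw ⟨1, by omega⟩ (by simp) (by simp only; omega)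
  have := hal.path.1 (h _ ⟨_, rfl⟩ _ ⟨j, rfl⟩ _ ⟨⟨j.val + 1, hj⟩, rfl⟩
    ((h1 j).2 (Or.inl rfl)) ((h1 ⟨j.val + 1, hj⟩).2 (Or.inr rfl)))
  have := congrArg Fin.val this
  simp only at this
  omega

section Alignment

variable {α : Type} {G : SimpleGraph α} {n k : ℕ} {p : Fin n → α} {e : Fin k → α}

theorem IsAlignment.notMem (h : IsAlignment G n p k e) (i : Fin k) : e i ∉ Set.range p := by
  rintro ⟨j, hj⟩
  exact h.disj i j hj.symm

theorem IsAlignment.spineWithLeg (h : IsAlignment G n p k e) (hk : 3 ≤ k)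
    (hst : StableSet G (Set.range e)) {j j' : Fin n}
    (hj : ∀ l, G.Adj (e ⟨1, by omega⟩) (p l) ↔ l = j ∨ l = j') :
    SpineWithLeg G (Set.range p) p j j' (e ⟨0, by omega⟩) (e ⟨1, by omega⟩)
      (e ⟨k - 1, by omega⟩) (e ⟨1, by omega⟩) {e ⟨1, by omega⟩} := by
  have hne : ∀ i i' : Fin k, i.val ≠ i'.val → e i ≠ e i' ∧ ¬ G.Adj (e i) (e i') := by
    intro i i' hi
    have : e i ≠ e i' := fun he => hi (congrArg Fin.val (h.injx he))
    exact ⟨this, hst _ ⟨i, rfl⟩ _ ⟨i', rfl⟩ this⟩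
  have h02 := hne ⟨0, by omega⟩ ⟨k - 1, by omega⟩ (by simp only; omega)
  refine ⟨h.path, fun l => ⟨l, rfl⟩, h.notMem _, h.notMem _, h.first, h.last, h02.1, h02.2,
    PathOn.single _, ?_, ?_, ?_, ?_, ?_⟩ <;> rintro v rfl
  · exact Or.inr rfl
  · exact h.disj _
  · simpa using hj
  · exact hne _ _ (by simp)
  · exact hne _ _ (by simp only; omega)

theorem IsSpikyAlignment.thetaHalf (h : IsSpikyAlignment G n p k e) (hk : 3 ≤ k)
    (hst : StableSet G (Set.range e)) :
    ∃ c ∈ Set.range p, ∃ S, ThetaHalf G (Set.range p) (sampleTriple hk e) c S := by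
  obtain ⟨j, hj, hu⟩ := h.2 ⟨1, by omega⟩ (by simp) (by simp only; omega)
  refine ⟨p j, ⟨j, rfl⟩, (h.1.spineWithLeg hk hst (j := j) (j' := j) fun l => ?_).thetaHalf⟩
  rw [or_self]
  exact ⟨hu l, fun hl => hl ▸ hj⟩

theorem IsSpikyAlignment.uniqueNbrIn (h : IsSpikyAlignment G n p k e) :
    UniqueNbrIn G (Set.range p) (Set.range e) := by
  rintro _ ⟨i, rfl⟩ _ ⟨l, rfl⟩ _ ⟨l', rfl⟩ hl hl'
  congr 1
  by_cases h0 : i.val = 0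
  · have hi : i = ⟨0, by have := h.1.hk; omega⟩ := Fin.ext h0
    rw [hi, h.1.first] at hl hl'
    exact Fin.ext (hl.trans hl'.symm)
  · by_cases h1 : i.val = k - 1
    · have hi : i = ⟨k - 1, by have := h.1.hk; omega⟩ := Fin.ext h1
      rw [hi, h.1.last] at hl hl'
      exact Fin.ext (hl.trans hl'.symm)
    · obtain ⟨j, hj, hu⟩ := h.2 i (by omega) (by have := i.isLt; omega)
      exact (hu l hl).trans (hu l' hl').symm

theorem IsTriangularAlignment.prismHalf (h : IsTriangularAlignment G n p k e) (hk : 3 ≤ k)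
    (hst : StableSet G (Set.range e)) :
    ∃ t S, PrismHalf G (Set.range p) (sampleTriple hk e) t S := by
  obtain ⟨j, hj, hu⟩ := h.2 ⟨1, by omega⟩ (by simp) (by simp only; omega)
  refine ⟨_, (h.1.spineWithLeg hk hst (j := j) (j' := ⟨j.val + 1, hj⟩) fun l => ?_).prismHalf rfl⟩
  rw [hu, Fin.ext_iff, Fin.ext_iff]

theorem IsWideAlignment.thetaHalf (h : IsWideAlignment G n p k e) (hk : 3 ≤ k)
    (hst : StableSet G (Set.range e)) :
    ∃ S, ThetaHalf G (Set.range p) (sampleTriple hk e) (e ⟨1, by omega⟩) S := by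
  classical
  obtain ⟨j, j', hjj, hj, hj'⟩ := h.2 ⟨1, by omega⟩ (by simp) (by simp only; omega)
  have h := h.1
  set x := e ⟨1, by omega⟩ with hx
  obtain ⟨s, hs, hsmin⟩ := Finset.exists_min_image (Finset.univ.filter fun l => G.Adj x (p l)) id
    ⟨j, by simpa using hj⟩
  obtain ⟨t, ht, htmax⟩ := Finset.exists_max_image (Finset.univ.filter fun l => G.Adj x (p l)) id
    ⟨j, by simpa using hj⟩
  simp only [Finset.mem_filter, Finset.mem_univ, true_and, id] at hs hsmin ht htmax
  have hst2 : s.val + 1 < t.val := by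
    have h1 : s.val ≤ j.val := hsmin j hj
    have h2 : j'.val ≤ t.val := htmax j' hj'
    omega
  have hne : ∀ i i' : Fin k, i.val ≠ i'.val → e i ≠ e i' ∧ ¬ G.Adj (e i) (e i') := by
    intro i i' hi
    have : e i ≠ e i' := fun he => hi (congrArg Fin.val (h.injx he))
    exact ⟨this, hst _ ⟨i, rfl⟩ _ ⟨i', rfl⟩ this⟩
  have h01 := hne ⟨1, by omega⟩ ⟨0, by omega⟩ (by simp)
  have h12 := hne ⟨1, by omega⟩ ⟨k - 1, by omega⟩ (by simp only; omega)
  have h02 := hne ⟨0, by omega⟩ ⟨k - 1, by omega⟩ (by simp only; omega)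
  refine ⟨![insert x (insert (e ⟨0, by omega⟩) {v | ∃ l, l ≤ s ∧ p l = v}), {x},
    insert x (insert (e ⟨k - 1, by omega⟩) {v | ∃ l, t ≤ l ∧ p l = v})], ?_, ?_, ?_⟩
  · intro i
    fin_cases i
    · refine ((PathOn.down h.path (h.disj _) h.first s).reverse.extend ?_ ?_).reverse
      · rintro (he | ⟨l, -, hl⟩)
        exacts [h01.1 he, h.disj _ l hl.symm]
      · rintro v (rfl | ⟨l, hl, rfl⟩)
        · exact ⟨fun ha => absurd ha h01.2, fun he => absurd he (h.disj _ s)⟩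
        · refine ⟨fun ha => ?_, fun he => he ▸ hs⟩
          rw [le_antisymm hl (hsmin l ha)]
    · exact PathOn.single x
    · refine ((PathOn.up h.path (h.disj _) h.last t).reverse.extend ?_ ?_).reverse
      · rintro (he | ⟨l, -, hl⟩)
        exacts [h12.1 he, h.disj _ l hl.symm]
      · rintro v (rfl | ⟨l, hl, rfl⟩)
        · exact ⟨fun ha => absurd ha h12.2, fun he => absurd he (h.disj _ t)⟩
        · refine ⟨fun ha => ?_, fun he => he ▸ ht⟩
          rw [le_antisymm hl (htmax l ha)]
  · intro i
    fin_cases i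
    · rintro u (rfl | rfl | ⟨l, -, rfl⟩)
      exacts [Or.inr (Or.inr rfl), Or.inr (Or.inl rfl), Or.inl ⟨l, rfl⟩]
    · rintro u rfl
      exact Or.inr (Or.inr rfl)
    · rintro u (rfl | rfl | ⟨l, -, rfl⟩)
      exacts [Or.inr (Or.inr rfl), Or.inr (Or.inl rfl), Or.inl ⟨l, rfl⟩]
  · refine forall_ne_fin_three ?_ ?_ ?_ ?_
    · intro i j hij u hu v hv huc hvc
      have := hij v hv u hu hvc huc
      exact ⟨this.1.symm, fun e => this.2 e.symm⟩
    · rintro u - v rfl - hvc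
      exact absurd rfl hvc
    · rintro u (rfl | rfl | ⟨l, hl, rfl⟩) v (rfl | rfl | ⟨l', hl', rfl⟩) huc hvc
      any_goals exact absurd rfl huc
      any_goals exact absurd rfl hvc
      · exact h02
      · refine ⟨h.disj _ l', fun ha => ?_⟩
        have := (h.first l').1 ha
        have hl' : t.val ≤ l'.val := hl'
        omega
      · refine ⟨(h.disj _ l).symm, fun ha => ?_⟩
        have := (h.last l).1 ha.symm
        have hl : l.val ≤ s.val := hl
        omega
      · have hl : l.val ≤ s.val := hl
        have hl' : t.val ≤ l'.val := hl'
        rw [h.path.1.ne_iff, h.path.2, Ne, Fin.ext_iff]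
        omega
    · rintro u rfl v - huc
      exact absurd rfl huc

end Alignment

/-- A path with a single leg, attached at its first vertex to `p j` and `p j'` and at its last
vertex to `x₁`. -/
theorem SpineWithLeg.ofLeg {α : Type} {G : SimpleGraph α} {A : Set α} {n m : ℕ} {p : Fin n → α}
    {ℓ : Fin m → α} {j j' : Fin n} {x₀ x₁ x₂ : α} (hm : 1 ≤ m) (hp : IsPathEmb G n p)
    (hℓ : IsPathEmb G m ℓ) (hpA : ∀ l, p l ∈ A) (hℓA : ∀ i, ℓ i ∈ A)
    (h₀ : x₀ ∉ A) (h₁ : x₁ ∉ A) (h₂ : x₂ ∉ A) (hne : ∀ i l, ℓ i ≠ p l)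
    (hℓp : ∀ i l, G.Adj (ℓ i) (p l) ↔ i.val = 0 ∧ (l = j ∨ l = j'))
    (hx₀ : ∀ l, G.Adj x₀ (p l) ↔ l.val = 0) (hx₂ : ∀ l, G.Adj x₂ (p l) ↔ l.val = n - 1)
    (hx₁ : ∀ l, ¬ G.Adj x₁ (p l)) (hx₀ℓ : ∀ i, ¬ G.Adj x₀ (ℓ i)) (hx₂ℓ : ∀ i, ¬ G.Adj x₂ (ℓ i))
    (hx₁ℓ : ∀ i, G.Adj x₁ (ℓ i) ↔ i.val = m - 1)
    (h01 : x₁ ≠ x₀ ∧ ¬ G.Adj x₁ x₀) (h12 : x₁ ≠ x₂ ∧ ¬ G.Adj x₁ x₂)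
    (h02 : x₀ ≠ x₂ ∧ ¬ G.Adj x₀ x₂) :
    SpineWithLeg G A p j j' x₀ x₁ x₂ (ℓ ⟨0, hm⟩) (insert x₁ (Set.range ℓ)) where
  path := hp
  mem := hpA
  notMem₀ := h₀
  notMem₂ := h₂
  adj₀ := hx₀
  adj₂ := hx₂
  ne := h02.1
  not_adj := h02.2
  leg := by
    refine (PathOn.ofEmb hℓ hm).extend ?_ ?_
    · rintro ⟨i, rfl⟩
      exact h₁ (hℓA i)
    · rintro _ ⟨i, rfl⟩
      rw [hx₁ℓ, hℓ.1.eq_iff, Fin.ext_iff]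
  leg_mem := by
    rintro v (rfl | ⟨i, rfl⟩)
    exacts [Or.inr rfl, Or.inl (hℓA i)]
  leg_ne := by
    rintro v (rfl | ⟨i, rfl⟩) l
    · exact fun e => h₁ (e ▸ hpA l)
    · exact hne i l
  leg_adj := by
    rintro v (rfl | ⟨i, rfl⟩) l
    · exact ⟨fun ha => absurd ha (hx₁ l), fun h => absurd (h.1 ▸ hℓA _) h₁⟩
    · rw [hℓp, hℓ.1.eq_iff, Fin.ext_iff (a := i)]
  leg₀ := by
    rintro v (rfl | ⟨i, rfl⟩)
    · exact h01
    · exact ⟨fun e => h₀ (e ▸ hℓA i), fun ha => hx₀ℓ i ha.symm⟩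
  leg₂ := by
    rintro v (rfl | ⟨i, rfl⟩)
    · exact h12
    · exact ⟨fun e => h₂ (e ▸ hℓA i), fun ha => hx₂ℓ i ha.symm⟩

section Connectifier

variable {α : Type} {G : SimpleGraph α} {A : Set α} {k : ℕ} {e : Fin k → α}

theorem IsSpikyConnectifier.thetaHalf (h : IsSpikyConnectifier G A k e) (hk : 3 ≤ k)
    (hst : StableSet G (Set.range e)) :
    ∃ c ∈ A, ¬ G.Adj (e ⟨1, by omega⟩) c ∧ ∃ S, ThetaHalf G A (sampleTriple hk e) c S := by
  obtain ⟨_, n, hn, p, m, ℓ, a, hp, hm, hℓ, rfl, hinj, hxA, hℓp, -, ha, -, hadj, hx₀, hx₀ℓ, hx₂,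
    hx₂ℓ, hx₁, hx₁ℓ⟩ := h
  have hne : ∀ i i' : Fin k, i.val ≠ i'.val → e i ≠ e i' ∧ ¬ G.Adj (e i) (e i') := by
    intro i i' hi
    have : e i ≠ e i' := fun he => hi (congrArg Fin.val (hinj he))
    exact ⟨this, hst _ ⟨i, rfl⟩ _ ⟨i', rfl⟩ this⟩
  let z : Fin (k - 2) := ⟨0, by omega⟩
  have haz := ha z
  refine ⟨p ⟨a z, by omega⟩, Or.inl ⟨_, rfl⟩, hx₁ z _, (SpineWithLeg.ofLeg (ℓ := ℓ z) (hm z) hp (hℓ z)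
    (fun l => Or.inl (Set.mem_range_self l))
    (fun i => Or.inr (Set.mem_iUnion.2 ⟨z, Set.mem_range_self i⟩))
    (hxA _) (hxA ⟨1, by omega⟩) (hxA _) (hℓp z) (fun i l => ?_) hx₀ hx₂ (hx₁ z) (hx₀ℓ z) (hx₂ℓ z)
    (fun i => ?_) (hne _ _ ?_) (hne _ _ ?_) (hne _ _ ?_)).thetaHalf⟩
  · rw [hadj, or_self, Fin.ext_iff]
  · refine (hx₁ℓ z z i).trans ?_
    simp
  all_goals (simp only; omega)

theorem IsTriangularConnectifier.prismHalf (h : IsTriangularConnectifier G A k e) (hk : 3 ≤ k)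
    (hst : StableSet G (Set.range e)) :
    ∃ t S, (∀ i, t i ∈ A) ∧ PrismHalf G A (sampleTriple hk e) t S := by
  obtain ⟨_, n, hn, p, m, ℓ, a, hp, hm, hℓ, rfl, hinj, hxA, hℓp, -, ha, -, hadj, hx₀, hx₀ℓ, hx₂,
    hx₂ℓ, hx₁, hx₁ℓ⟩ := h
  have hne : ∀ i i' : Fin k, i.val ≠ i'.val → e i ≠ e i' ∧ ¬ G.Adj (e i) (e i') := by
    intro i i' hi
    have : e i ≠ e i' := fun he => hi (congrArg Fin.val (hinj he))
    exact ⟨this, hst _ ⟨i, rfl⟩ _ ⟨i', rfl⟩ this⟩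
  let z : Fin (k - 2) := ⟨0, by omega⟩
  have haz := ha z
  obtain ⟨S, hS⟩ := (SpineWithLeg.ofLeg (G := G) (ℓ := ℓ z) (j := ⟨a z, by omega⟩)
    (j' := ⟨a z + 1, by omega⟩) (hm z) hp (hℓ z)
    (fun l => Or.inl (Set.mem_range_self l))
    (fun i => Or.inr (Set.mem_iUnion.2 ⟨z, Set.mem_range_self i⟩))
    (hxA _) (hxA ⟨1, by omega⟩) (hxA _) (hℓp z)
    (fun i l => (hadj z i l).trans (by rw [Fin.ext_iff, Fin.ext_iff])) hx₀ hx₂ (hx₁ z) (hx₀ℓ z) (hx₂ℓ z)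
    (fun i => (hx₁ℓ z z i).trans (by simp)) (hne _ _ (by simp)) (hne _ _ (by simp only; omega))
    (hne _ _ (by simp only; omega))).prismHalf rfl
  refine ⟨_, S, fun i => ?_, hS⟩
  fin_cases i
  exacts [Or.inl ⟨_, rfl⟩, Or.inr (Set.mem_iUnion.2 ⟨z, _, rfl⟩), Or.inl ⟨_, rfl⟩]

/-- If the two extreme vertices of `e` attach at the ends of a path and the others attach at the
tips of its legs, then each vertex of `e` has at most one neighbor. -/
theorem uniqueNbrIn_of_legs {n : ℕ} {p : Fin n → α} {m : Fin (k - 2) → ℕ}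
    {ℓ : ∀ i, Fin (m i) → α} (hk : 2 ≤ k)
    (hx₀ : ∀ j : Fin n, G.Adj (e ⟨0, by omega⟩) (p j) ↔ j.val = 0)
    (hx₀ℓ : ∀ (i : Fin (k - 2)) (j : Fin (m i)), ¬ G.Adj (e ⟨0, by omega⟩) (ℓ i j))
    (hx₂ : ∀ j : Fin n, G.Adj (e ⟨k - 1, by omega⟩) (p j) ↔ j.val = n - 1)
    (hx₂ℓ : ∀ (i : Fin (k - 2)) (j : Fin (m i)), ¬ G.Adj (e ⟨k - 1, by omega⟩) (ℓ i j))
    (hx₁ : ∀ (i : Fin (k - 2)) (j : Fin n),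
      ¬ G.Adj (e ⟨i.val + 1, by have := i.isLt; omega⟩) (p j))
    (hx₁ℓ : ∀ (i i' : Fin (k - 2)) (j : Fin (m i')),
      G.Adj (e ⟨i.val + 1, by have := i.isLt; omega⟩) (ℓ i' j) ↔ (i' = i ∧ j.val = m i' - 1)) :
    UniqueNbrIn G (Set.range p ∪ ⋃ i, Set.range (ℓ i)) (Set.range e) := by
  rintro _ ⟨i, rfl⟩ u hu v hv hiu hiv
  by_cases h0 : i.val = 0
  · have hi : i = ⟨0, by omega⟩ := Fin.ext h0
    rw [hi] at hiu hiv
    have key : ∀ w ∈ Set.range p ∪ ⋃ i, Set.range (ℓ i), G.Adj (e ⟨0, by omega⟩) w →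
        ∃ j : Fin n, j.val = 0 ∧ p j = w := by
      rintro w (⟨j, rfl⟩ | hw) hadj
      · exact ⟨j, (hx₀ j).1 hadj, rfl⟩
      · obtain ⟨i', j, rfl⟩ := Set.mem_iUnion.1 hw
        exact absurd hadj (hx₀ℓ i' j)
    obtain ⟨j, hj, rfl⟩ := key u hu hiu
    obtain ⟨j', hj', rfl⟩ := key v hv hiv
    exact congrArg p (Fin.ext (hj.trans hj'.symm))
  · by_cases h1 : i.val = k - 1
    · have hi : i = ⟨k - 1, by omega⟩ := Fin.ext h1
      rw [hi] at hiu hiv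
      have key : ∀ w ∈ Set.range p ∪ ⋃ i, Set.range (ℓ i), G.Adj (e ⟨k - 1, by omega⟩) w →
          ∃ j : Fin n, j.val = n - 1 ∧ p j = w := by
        rintro w (⟨j, rfl⟩ | hw) hadj
        · exact ⟨j, (hx₂ j).1 hadj, rfl⟩
        · obtain ⟨i', j, rfl⟩ := Set.mem_iUnion.1 hw
          exact absurd hadj (hx₂ℓ i' j)
      obtain ⟨j, hj, rfl⟩ := key u hu hiu
      obtain ⟨j', hj', rfl⟩ := key v hv hiv
      exact congrArg p (Fin.ext (hj.trans hj'.symm))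
    · have hik := i.isLt
      obtain ⟨i₀, hi⟩ : ∃ i₀ : Fin (k - 2), i = ⟨i₀.val + 1, by have := i₀.isLt; omega⟩ :=
        ⟨⟨i.val - 1, by omega⟩, Fin.ext (by simp only; omega)⟩
      rw [hi] at hiu hiv
      have key : ∀ w ∈ Set.range p ∪ ⋃ i, Set.range (ℓ i),
          G.Adj (e ⟨i₀.val + 1, by have := i₀.isLt; omega⟩) w →
          ∃ j : Fin (m i₀), j.val = m i₀ - 1 ∧ ℓ i₀ j = w := by
        rintro w (⟨j, rfl⟩ | hw) hadj
        · exact absurd hadj (hx₁ i₀ j)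
        · obtain ⟨i', j, rfl⟩ := Set.mem_iUnion.1 hw
          obtain ⟨rfl, hj⟩ := (hx₁ℓ i₀ i' j).1 hadj
          exact ⟨j, hj, rfl⟩
      obtain ⟨j, hj, rfl⟩ := key u hu hiu
      obtain ⟨j', hj', rfl⟩ := key v hv hiv
      exact congrArg _ (Fin.ext (hj.trans hj'.symm))

theorem IsSpikyConnectifier.uniqueNbrIn (h : IsSpikyConnectifier G A k e) :
    UniqueNbrIn G A (Set.range e) := by
  obtain ⟨hk, n, hn, p, m, ℓ, a, -, -, -, rfl, -, -, -, -, -, -, -, hx₀, hx₀ℓ, hx₂,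
    hx₂ℓ, hx₁, hx₁ℓ⟩ := h
  exact uniqueNbrIn_of_legs hk hx₀ hx₀ℓ hx₂ hx₂ℓ hx₁ hx₁ℓ

theorem IsTriangularConnectifier.uniqueNbrIn (h : IsTriangularConnectifier G A k e) :
    UniqueNbrIn G A (Set.range e) := by
  obtain ⟨hk, n, hn, p, m, ℓ, a, -, -, -, rfl, -, -, -, -, -, -, -, hx₀, hx₀ℓ, hx₂,
    hx₂ℓ, hx₁, hx₁ℓ⟩ := h
  exact uniqueNbrIn_of_legs hk hx₀ hx₀ℓ hx₂ hx₂ℓ hx₁ hx₁ℓ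

theorem IsStellarConnectifier.uniqueNbrIn (h : IsStellarConnectifier G A k e) :
    UniqueNbrIn G A (Set.range e) := by
  obtain ⟨hk, r, m, ℓ, -, -, rfl, -, -, -, -, -, hxr, hxℓ⟩ := h
  rintro _ ⟨i, rfl⟩ u hu v hv hiu hiv
  have key : ∀ w ∈ {r} ∪ ⋃ i, Set.range (ℓ i), G.Adj (e i) w →
      ∃ j : Fin (m i), j.val = m i - 1 ∧ ℓ i j = w := by
    rintro w (rfl | hw) hadj
    · exact absurd hadj (hxr i)
    · obtain ⟨i', j, rfl⟩ := Set.mem_iUnion.1 hw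
      obtain ⟨rfl, hj⟩ := (hxℓ i i' j).1 hadj
      exact ⟨j, hj, rfl⟩
  obtain ⟨j, hj, rfl⟩ := key u hu hiu
  obtain ⟨j', hj', rfl⟩ := key v hv hiv
  exact congrArg _ (Fin.ext (hj.trans hj'.symm))

theorem IsStellarConnectifier.thetaHalf (h : IsStellarConnectifier G A k e)
    (hst : StableSet G (Set.range e)) {y : Fin 3 → α} (hy : Function.Injective y)
    (hyX : ∀ i, y i ∈ Set.range e) :
    ∃ c ∈ A, (∀ i, ¬ G.Adj (e i) c) ∧ ∃ S, ThetaHalf G A y c S := by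
  obtain ⟨hk, r, m, ℓ, hm, hℓ, rfl, hinj, hxA, hℓr, hℓℓ, hrℓ, hxr, hxℓ⟩ := h
  choose σ hσ using hyX
  obtain rfl : (fun i => e (σ i)) = y := funext hσ
  have hmemℓ : ∀ i j, ℓ i j ∈ {r} ∪ ⋃ i, Set.range (ℓ i) := fun i j =>
    Or.inr (Set.mem_iUnion.2 ⟨i, j, rfl⟩)
  have hmemr : r ∈ {r} ∪ ⋃ i, Set.range (ℓ i) := Or.inl rfl
  have hexr : ∀ i, e i ≠ r := fun i h => hxA i (h ▸ hmemr)
  have heℓ : ∀ i i' j, e i ≠ ℓ i' j := fun i i' j h => hxA i (h ▸ hmemℓ i' j)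
  refine ⟨r, hmemr, hxr, fun i => insert (e (σ i)) (insert r (Set.range (ℓ (σ i)))), ?_, ?_, ?_⟩
  · intro i
    refine ((PathOn.ofEmb (hℓ (σ i)) (hm _)).reverse.extend ?_ ?_).reverse.extend ?_ ?_
    · rintro ⟨j, hj⟩
      exact hℓr _ _ hj
    · rintro _ ⟨j, rfl⟩
      rw [hrℓ, (hℓ (σ i)).1.eq_iff, Fin.ext_iff]
    · rintro (h | ⟨j, hj⟩)
      exacts [hexr _ h, heℓ _ _ j hj.symm]
    · rintro v (rfl | ⟨j, rfl⟩)
      · exact ⟨fun h => absurd h (hxr _), fun h => absurd h.symm (hℓr _ _)⟩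
      · rw [hxℓ, (hℓ (σ i)).1.eq_iff, Fin.ext_iff (a := j)]
        simp
  · rintro i u (rfl | rfl | ⟨j, rfl⟩)
    exacts [Or.inr (Or.inl rfl), Or.inr (Or.inr rfl), Or.inl (hmemℓ _ j)]
  · intro i i' hii' u hu v hv hur hvr
    have hσ' : σ i ≠ σ i' := fun h => hii' (hy (congrArg e h))
    rcases hu with rfl | rfl | ⟨j, rfl⟩ <;> rcases hv with rfl | rfl | ⟨j', rfl⟩
    any_goals exact absurd rfl hur
    any_goals exact absurd rfl hvr
    · have := hinj.ne hσ'
      exact ⟨this, hst _ ⟨_, rfl⟩ _ ⟨_, rfl⟩ this⟩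
    · exact ⟨heℓ _ _ _, fun h => hσ' ((hxℓ _ _ _).1 h).1.symm⟩
    · exact ⟨(heℓ _ _ _).symm, fun h => hσ' ((hxℓ _ _ _).1 h.symm).1⟩
    · exact hℓℓ _ _ hσ' j j'

end Connectifier

theorem isHub_of_four_nbrs {α : Type} {G : SimpleGraph α} {H : Set α} {x : α} (hH : IsHole G H)
    (hx : x ∉ H) (h4 : 4 ≤ (holeNbrs G H x).ncard) : IsHub G x := by
  have hle : ∀ p q r : α, holeNbrs G H x = {p, q, r} → False := by
    intro p q r h
    have h3 : (({p, q, r} : Set α)).ncard ≤ 3 :=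
      (Set.ncard_insert_le _ _).trans (Nat.succ_le_succ ((Set.ncard_insert_le q {r}).trans
        (Nat.succ_le_succ (Set.ncard_singleton r).le)))
    rw [h] at h4
    omega
  exact ⟨H, ⟨hH, hx, by omega⟩, fun ⟨_, p, q, r, _, _, _, h, _⟩ => hle p q r h,
    fun ⟨_, p, q, r, _, _, _, h, _⟩ => hle p q r h⟩

theorem isHub_of_stable_nbrs {α : Type} [Finite α] {G : SimpleGraph α} {H : Set α} {x a b c : α}
    (hH : IsHole G H) (hx : x ∉ H) (ha : a ∈ holeNbrs G H x) (hb : b ∈ holeNbrs G H x)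
    (hc : c ∈ holeNbrs G H x) (hab : a ≠ b) (hac : a ≠ c) (hbc : b ≠ c)
    (nab : ¬ G.Adj a b) (nac : ¬ G.Adj a c) (nbc : ¬ G.Adj b c) : IsHub G x := by
  have hsub : ({a, b, c} : Set α) ⊆ holeNbrs G H x := by
    rintro v (rfl | rfl | rfl) <;> assumption
  have h3 : ({a, b, c} : Set α).ncard = 3 := Set.ncard_eq_three.2 ⟨a, b, c, hab, hac, hbc, rfl⟩
  have hkey : ∀ p q r : α, p ≠ q → q ≠ r → p ≠ r → holeNbrs G H x = {p, q, r} →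
      ¬ G.Adj p q := by
    intro p q r hpq hqr hpr h hadj
    have hpqr : ({p, q, r} : Set α).ncard = 3 := Set.ncard_eq_three.2 ⟨p, q, r, hpq, hpr, hqr, rfl⟩
    have heq : ({a, b, c} : Set α) = {p, q, r} :=
      Set.eq_of_subset_of_ncard_le (h ▸ hsub) (by omega) (Set.toFinite _)
    have hp : p ∈ ({a, b, c} : Set α) := heq ▸ Or.inl rfl
    have hq : q ∈ ({a, b, c} : Set α) := heq ▸ Or.inr (Or.inl rfl)
    rcases hp with rfl | rfl | rfl <;> rcases hq with rfl | rfl | rfl <;>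
      first | exact hpq rfl | exact nab hadj | exact nac hadj | exact nbc hadj |
        exact nab hadj.symm | exact nac hadj.symm | exact nbc hadj.symm
  refine ⟨H, ⟨hH, hx, h3 ▸ Set.ncard_le_ncard hsub (Set.toFinite _)⟩, ?_, ?_⟩
  · rintro ⟨_, p, q, r, hpq, hqr, hpr, h, hadj, -⟩
    exact hkey p q r hpq hqr hpr h hadj
  · rintro ⟨_, p, q, r, hpq, hqr, hpr, h, hadj, -⟩
    exact hkey p q r hpq hqr hpr h hadj

/-- Two alignments of the same enumeration along anticomplete paths close up to a hole. -/
theorem IsAlignment.isHole {α : Type} {G : SimpleGraph α} {n m k : ℕ} {p : Fin n → α}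
    {q : Fin m → α} {e : Fin k → α} (hk : 3 ≤ k) (hp : IsAlignment G n p k e)
    (hq : IsAlignment G m q k e) (hst : StableSet G (Set.range e))
    (hdis : Disjoint (Set.range p) (Set.range q))
    (hanti : Anticomplete G (Set.range p) (Set.range q)) :
    IsHole G (insert (e ⟨0, by omega⟩) (insert (e ⟨k - 1, by omega⟩) (Set.range p) ∪
      insert (e ⟨k - 1, by omega⟩) (Set.range q))) := by
  have hne : ∀ i j, p i ≠ q j := fun i j h => Set.disjoint_left.1 hdis ⟨i, rfl⟩ ⟨j, h.symm⟩
  have hx : e ⟨0, by omega⟩ ≠ e ⟨k - 1, by omega⟩ := by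
    intro h
    have := congrArg Fin.val (hp.injx h)
    simp only at this
    omega
  have hxadj := hst _ ⟨_, rfl⟩ _ ⟨_, rfl⟩ hx
  have ext : ∀ {l : ℕ} {r : Fin l → α} (hr : IsAlignment G l r k e),
      PathOn G (r ⟨0, hr.hn⟩) (e ⟨k - 1, by omega⟩)
        (insert (e ⟨k - 1, by omega⟩) (Set.range r)) := by
    intro l r hr
    refine (PathOn.ofEmb hr.path hr.hn).extend (hr.notMem _) ?_
    rintro _ ⟨i, rfl⟩
    rw [hr.last, hr.path.1.eq_iff, Fin.ext_iff]
  refine ((ext hp).trans (ext hq).reverse ?_).isHole (hne _ _) ?_ ?_ ?_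
  · rintro u (rfl | ⟨i, rfl⟩) v (rfl | ⟨j, rfl⟩) hu hv
    any_goals exact absurd rfl hu
    any_goals exact absurd rfl hv
    exact ⟨hne i j, hanti _ ⟨i, rfl⟩ _ ⟨j, rfl⟩⟩
  · exact hanti _ ⟨_, rfl⟩ _ ⟨_, rfl⟩
  · rintro ((h | h) | (h | h))
    exacts [hx h, hp.notMem _ h, hx h, hq.notMem _ h]
  · rintro v ((rfl | ⟨i, rfl⟩) | (rfl | ⟨i, rfl⟩))
    · exact ⟨fun h => absurd h hxadj, fun h => h.elim (fun h => absurd h (hp.disj _ _))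
        (fun h => absurd h (hq.disj _ _))⟩
    · rw [hp.first, hp.path.1.eq_iff, Fin.ext_iff]
      exact ⟨Or.inl, fun h => h.resolve_right (hne _ _)⟩
    · exact ⟨fun h => absurd h hxadj, fun h => h.elim (fun h => absurd h (hp.disj _ _))
        (fun h => absurd h (hq.disj _ _))⟩
    · rw [hq.first, hq.path.1.eq_iff, Fin.ext_iff]
      exact ⟨Or.inr, fun h => h.resolve_left (fun h => hne _ _ h.symm)⟩

theorem IsAlignment.second_notMem_hole {α : Type} {G : SimpleGraph α} {n m k : ℕ} {p : Fin n → α}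
    {q : Fin m → α} {e : Fin k → α} (hk : 3 ≤ k) (hp : IsAlignment G n p k e)
    (hq : IsAlignment G m q k e) :
    e ⟨1, by omega⟩ ∉ insert (e ⟨0, by omega⟩) (insert (e ⟨k - 1, by omega⟩) (Set.range p) ∪
      insert (e ⟨k - 1, by omega⟩) (Set.range q)) := by
  have hne : ∀ i i' : Fin k, i.val ≠ i'.val → e i ≠ e i' :=
    fun i i' hi he => hi (congrArg Fin.val (hp.injx he))
  have h1 := hne ⟨1, by omega⟩ ⟨0, by omega⟩ (by simp)
  have h2 := hne ⟨1, by omega⟩ ⟨k - 1, by omega⟩ (by simp only; omega)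
  rintro (h | (h | h) | (h | h))
  exacts [h1 h, h2 h, hp.notMem _ h, h2 h, hq.notMem _ h]

theorem IsWideAlignment.isHub {α : Type} [Finite α] {G : SimpleGraph α} {n m k : ℕ}
    {p : Fin n → α} {q : Fin m → α} {e : Fin k → α} (hk : 3 ≤ k) (hp : IsWideAlignment G n p k e)
    (hq : IsAlignment G m q k e) (hst : StableSet G (Set.range e))
    (hdis : Disjoint (Set.range p) (Set.range q))
    (hanti : Anticomplete G (Set.range p) (Set.range q)) : IsHub G (e ⟨1, by omega⟩) := by
  have hne : ∀ i j, p i ≠ q j := fun i j h => Set.disjoint_left.1 hdis ⟨i, rfl⟩ ⟨j, h.symm⟩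
  have hanti' : ∀ i j, ¬ G.Adj (p i) (q j) := fun i j => hanti _ ⟨i, rfl⟩ _ ⟨j, rfl⟩
  obtain ⟨j, j', hjj, hj, hj'⟩ := hp.2 ⟨1, by omega⟩ (by simp) (by simp only; omega)
  obtain ⟨l, hl⟩ := hq.cover ⟨1, by omega⟩
  refine isHub_of_stable_nbrs (hp.1.isHole hk hq hst hdis hanti) (hp.1.second_notMem_hole hk hq)
    (a := p j) (b := p j') (c := q l) ⟨Or.inr (Or.inl (Or.inr ⟨j, rfl⟩)), hj⟩
    ⟨Or.inr (Or.inl (Or.inr ⟨j', rfl⟩)), hj'⟩ ⟨Or.inr (Or.inr (Or.inr ⟨l, rfl⟩)), hl⟩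
    ?_ (hne _ _) (hne _ _) ?_ (hanti' _ _) (hanti' _ _)
  · rw [hp.1.path.1.ne_iff, Ne, Fin.ext_iff]
    omega
  · rw [hp.1.path.2]
    omega

theorem IsTriangularAlignment.isHub {α : Type} [Finite α] {G : SimpleGraph α} {n m k : ℕ}
    {p : Fin n → α} {q : Fin m → α} {e : Fin k → α} (hk : 3 ≤ k)
    (hp : IsTriangularAlignment G n p k e) (hq : IsTriangularAlignment G m q k e)
    (hst : StableSet G (Set.range e)) (hdis : Disjoint (Set.range p) (Set.range q))
    (hanti : Anticomplete G (Set.range p) (Set.range q)) : IsHub G (e ⟨1, by omega⟩) := by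
  have hne : ∀ i j, p i ≠ q j := fun i j h => Set.disjoint_left.1 hdis ⟨i, rfl⟩ ⟨j, h.symm⟩
  obtain ⟨j, hj, hpj⟩ := hp.2 ⟨1, by omega⟩ (by simp) (by simp only; omega)
  obtain ⟨l, hl, hql⟩ := hq.2 ⟨1, by omega⟩ (by simp) (by simp only; omega)
  refine isHub_of_four_nbrs (hp.1.isHole hk hq.1 hst hdis hanti)
    (hp.1.second_notMem_hole hk hq.1) ?_
  have hpp : p j ≠ p ⟨j.val + 1, hj⟩ := by
    rw [hp.1.path.1.ne_iff, Ne, Fin.ext_iff]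
    simp
  have hqq : q l ≠ q ⟨l.val + 1, hl⟩ := by
    rw [hq.1.path.1.ne_iff, Ne, Fin.ext_iff]
    simp
  have h4 : ({p j, p ⟨j.val + 1, hj⟩} ∪ {q l, q ⟨l.val + 1, hl⟩} : Set α).ncard = 4 := by
    rw [Set.ncard_union_eq, Set.ncard_pair hpp, Set.ncard_pair hqq]
    rw [Set.disjoint_left]
    rintro v (rfl | rfl) (h | h)
    exacts [hne _ _ h, hne _ _ h, hne _ _ h, hne _ _ h]
  rw [← h4]
  refine Set.ncard_le_ncard ?_ (Set.toFinite _)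
  rintro v ((rfl | rfl) | (rfl | rfl))
  · exact ⟨Or.inr (Or.inl (Or.inr ⟨_, rfl⟩)), (hpj _).2 (Or.inl rfl)⟩
  · exact ⟨Or.inr (Or.inl (Or.inr ⟨_, rfl⟩)), (hpj _).2 (Or.inr rfl)⟩
  · exact ⟨Or.inr (Or.inr (Or.inr ⟨_, rfl⟩)), (hql _).2 (Or.inl rfl)⟩
  · exact ⟨Or.inr (Or.inr (Or.inr ⟨_, rfl⟩)), (hql _).2 (Or.inr rfl)⟩

/-- The conclusion of the classification with the roles of the two sides fixed. -/
def IsTriangularOpposite {α : Type} (G : SimpleGraph α) (X A B : Set α) : Prop :=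
  (IsTriAlignSet G A X ∨ IsTriConnSet G A X) ∧
    (IsSpikyConnSet G B X ∨ IsStellarConnSet G B X ∨
      IsSpikyAlignSet G B X ∨ IsWideAlignSet G B X) ∧
    (IsTriAlignSet G A X → ¬ IsWideAlignSet G B X)

section Classification

variable {α : Type} {G : SimpleGraph α} {A B X : Set α} {k : ℕ} {e : Fin k → α}

theorem IsConsistentWith.injective (h : IsConsistentWith G A k e) : Function.Injective e := by
  rcases h with ⟨n, p, -, h | h | h⟩ | h | h | h
  · exact h.1.injx
  · exact h.1.injx
  · exact h.1.injx
  · obtain ⟨_, n, hn, p, m, ℓ, a, -, -, -, -, h, -⟩ := h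
    exact h
  · obtain ⟨_, n, hn, p, m, ℓ, a, -, -, -, -, h, -⟩ := h
    exact h
  · obtain ⟨_, r, m, ℓ, -, -, -, h, -⟩ := h
    exact h

theorem sampleTriple_injective (hk : 3 ≤ k) (he : Function.Injective e) :
    Function.Injective (sampleTriple hk e) := by
  obtain ⟨σ, hσ, h⟩ := sampleTriple_eq hk e
  rw [h]
  exact he.comp hσ

theorem sampleTriple_mem (hk : 3 ≤ k) (i : Fin 3) : sampleTriple hk e i ∈ Set.range e := by
  obtain ⟨σ, -, h⟩ := sampleTriple_eq hk e
  rw [h]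
  exact ⟨_, rfl⟩

/-- A stellar side forces the other side to be triangular. -/
theorem IsStellarConnSet.isTriangularOpposite (hA : IsStellarConnSet G A X)
    (htheta : ¬ HasTheta G) (hk : 3 ≤ k) (he : X = Set.range e)
    (hB : IsConsistentWith G B k e) (hAX : Disjoint A X)
    (hAB : Disjoint A B) (hanti : Anticomplete G A B) (hst : StableSet G X) :
    IsTriangularOpposite G X B A := by
  have hAs := hA
  obtain ⟨k', e', he', hA⟩ := hA
  have hX3 : 3 ≤ X.ncard := by
    rw [he, Set.ncard_range_of_injective hB.injective]
    simpa using hk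
  have hwide : ¬ IsWideAlignSet G A X := (he' ▸ hA.uniqueNbrIn).not_isWideAlignSet hX3
  have hyX : ∀ i, sampleTriple hk e i ∈ X := fun i => he ▸ sampleTriple_mem hk i
  have hinj := sampleTriple_injective hk hB.injective
  obtain ⟨d, hd, hed, S, hS⟩ := hA.thetaHalf (he' ▸ hst) hinj (fun i => he' ▸ hyX i)
  have hyA : ∀ i, sampleTriple hk e i ∉ A := fun i h => Set.disjoint_left.1 hAX h (hyX i)
  have hspiky : ¬ ∃ c ∈ B, ∃ T, ThetaHalf G B (sampleTriple hk e) c T := by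
    rintro ⟨c, hc, T, hT⟩
    exact htheta (hT.hasTheta hS hAB.symm hanti.symm hyA hd (Or.inl hc)
      (fun h => Set.disjoint_left.1 hAB hd (h ▸ hc)) (hanti.symm c hc d hd))
  have hst' : StableSet G (Set.range e) := he ▸ hst
  rcases hB with ⟨n, p, rfl, h | h | h⟩ | h | h | h
  · obtain ⟨T, hT⟩ := h.thetaHalf hk hst'
    obtain ⟨i, hi⟩ : sampleTriple hk e 1 ∈ Set.range e' := he' ▸ hyX 1
    exact absurd (hT.hasTheta hS hAB.symm hanti.symm hyA hd (Or.inr ⟨1, rfl⟩)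
      (fun h => hyA 1 (Set.mem_of_eq_of_mem h hd)) fun hadj => hed i (hi ▸ hadj)) htheta
  · exact absurd (h.thetaHalf hk hst') hspiky
  · exact ⟨Or.inl ⟨n, k, p, e, rfl, he, h⟩, Or.inr (Or.inl hAs), fun _ => hwide⟩
  · obtain ⟨c, hc, -, hT⟩ := h.thetaHalf hk hst'
    exact absurd ⟨c, hc, hT⟩ hspiky
  · exact ⟨Or.inr ⟨k, e, he, h⟩, Or.inr (Or.inl hAs), fun _ => hwide⟩
  · obtain ⟨c, hc, -, hT⟩ := h.thetaHalf hst' hinj (sampleTriple_mem hk)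
    exact absurd ⟨c, hc, hT⟩ hspiky

theorem IsTriangularAlignment.isTriangularOpposite [Finite α] {n : ℕ} {p : Fin n → α}
    (h : IsTriangularAlignment G n p k e) (hprism : ¬ HasPrism G) (hk : 3 ≤ k)
    (hnohub : ¬ IsHub G (e ⟨1, by omega⟩)) (hB : IsConsistentWith G B k e)
    (hBs : ¬ IsStellarConnSet G B (Set.range e)) (hBX : Disjoint B (Set.range e))
    (hAB : Disjoint (Set.range p) B) (hanti : Anticomplete G (Set.range p) B)
    (hst : StableSet G (Set.range e)) : IsTriangularOpposite G (Set.range e) (Set.range p) B := by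
  have hX3 : 3 ≤ (Set.range e).ncard := by
    rw [Set.ncard_range_of_injective hB.injective]
    simpa using hk
  have hA : IsTriAlignSet G (Set.range p) (Set.range e) := ⟨n, k, p, e, rfl, rfl, h⟩
  rcases hB with ⟨m, q, rfl, hq | hq | hq⟩ | hq | hq | hq
  · exact absurd (hq.isHub hk h.1 hst hAB.symm hanti.symm) hnohub
  · exact ⟨Or.inl hA, Or.inr (Or.inr (Or.inl ⟨m, k, q, e, rfl, rfl, hq⟩)),
      fun _ => hq.uniqueNbrIn.not_isWideAlignSet hX3⟩
  · exact absurd (h.isHub hk hq hst hAB hanti) hnohub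
  · exact ⟨Or.inl hA, Or.inl ⟨k, e, rfl, hq⟩,
      fun _ => hq.uniqueNbrIn.not_isWideAlignSet hX3⟩
  · obtain ⟨t, S, hS⟩ := h.prismHalf hk hst
    obtain ⟨t', T, ht', hT⟩ := hq.prismHalf hk hst
    exact absurd (hS.hasPrism hT hAB hanti
      (fun i hi => Set.disjoint_left.1 hBX hi (sampleTriple_mem hk i)) ht') hprism
  · exact absurd ⟨k, e, rfl, hq⟩ hBs

theorem IsTriangularConnectifier.isTriangularOpposite (h : IsTriangularConnectifier G A k e)
    (hprism : ¬ HasPrism G) (hk : 3 ≤ k) (hB : IsConsistentWith G B k e)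
    (hBs : ¬ IsStellarConnSet G B (Set.range e)) (hAX : Disjoint A (Set.range e))
    (hAB : Disjoint A B) (hanti : Anticomplete G A B) (hst : StableSet G (Set.range e)) :
    IsTriangularOpposite G (Set.range e) A B := by
  have hX3 : 3 ≤ (Set.range e).ncard := by
    rw [Set.ncard_range_of_injective hB.injective]
    simpa using hk
  have hA : IsTriConnSet G A (Set.range e) := ⟨k, e, rfl, h⟩
  have hlast : IsTriAlignSet G A (Set.range e) → ¬ IsWideAlignSet G B (Set.range e) :=
    fun hal => absurd hal (h.uniqueNbrIn.not_isTriAlignSet hX3)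
  obtain ⟨t, S, ht, hS⟩ := h.prismHalf hk hst
  have hnoprism : ¬ ∃ t T, PrismHalf G B (sampleTriple hk e) t T := by
    rintro ⟨t', T, hT⟩
    exact hprism (hT.hasPrism hS hAB.symm hanti.symm
      (fun i hi => Set.disjoint_left.1 hAX hi (sampleTriple_mem hk i)) ht)
  rcases hB with ⟨m, q, rfl, hq | hq | hq⟩ | hq | hq | hq
  · exact ⟨Or.inr hA, Or.inr (Or.inr (Or.inr ⟨m, k, q, e, rfl, rfl, hq⟩)), hlast⟩
  · exact ⟨Or.inr hA, Or.inr (Or.inr (Or.inl ⟨m, k, q, e, rfl, rfl, hq⟩)), hlast⟩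
  · exact absurd (hq.prismHalf hk hst) hnoprism
  · exact ⟨Or.inr hA, Or.inl ⟨k, e, rfl, hq⟩, hlast⟩
  · obtain ⟨t', T, -, hT⟩ := hq.prismHalf hk hst
    exact absurd ⟨t', T, hT⟩ hnoprism
  · exact absurd ⟨k, e, rfl, hq⟩ hBs

/-- A wide alignment and a spiky connectifier with the same enumeration form a theta. -/
theorem IsWideAlignment.hasTheta {n : ℕ} {p : Fin n → α} (h : IsWideAlignment G n p k e)
    (hB : IsSpikyConnectifier G B k e) (hk : 3 ≤ k) (hBX : Disjoint B (Set.range e))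
    (hAB : Disjoint (Set.range p) B) (hanti : Anticomplete G (Set.range p) B)
    (hst : StableSet G (Set.range e)) : HasTheta G := by
  obtain ⟨S, hS⟩ := h.thetaHalf hk hst
  obtain ⟨d, hd, hed, T, hT⟩ := hB.thetaHalf hk hst
  exact hS.hasTheta hT hAB hanti
    (fun i hi => Set.disjoint_left.1 hBX hi (sampleTriple_mem hk i)) hd (Or.inr ⟨1, rfl⟩)
    (fun h => Set.disjoint_left.1 hBX hd ⟨_, h⟩) hed

theorem isTriangularOpposite_or [Finite α] (htheta : ¬ HasTheta G) (hprism : ¬ HasPrism G)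
    (hk : 3 ≤ k) (hnohub : ¬ IsHub G (e ⟨1, by omega⟩)) (hA : IsConsistentWith G A k e)
    (hB : IsConsistentWith G B k e) (hAs : ¬ IsStellarConnSet G A (Set.range e))
    (hBs : ¬ IsStellarConnSet G B (Set.range e)) (hAX : Disjoint A (Set.range e))
    (hBX : Disjoint B (Set.range e)) (hAB : Disjoint A B) (hanti : Anticomplete G A B)
    (hst : StableSet G (Set.range e)) :
    IsTriangularOpposite G (Set.range e) A B ∨ IsTriangularOpposite G (Set.range e) B A := by
  have htwo : (∃ c ∈ A, ∃ S, ThetaHalf G A (sampleTriple hk e) c S) →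
      ¬ ∃ d ∈ B, ∃ T, ThetaHalf G B (sampleTriple hk e) d T := by
    rintro ⟨c, hc, S, hS⟩ ⟨d, hd, T, hT⟩
    exact htheta (hS.hasTheta hT hAB hanti
      (fun i hi => Set.disjoint_left.1 hBX hi (sampleTriple_mem hk i)) hd (Or.inl hc)
      (fun h => Set.disjoint_left.1 hAB hc (h ▸ hd)) (hanti c hc d hd))
  have hconn : ∀ {D : Set α}, IsSpikyConnectifier G D k e →
      ∃ c ∈ D, ∃ S, ThetaHalf G D (sampleTriple hk e) c S := by
    intro D h
    obtain ⟨c, hc, -, hS⟩ := h.thetaHalf hk hst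
    exact ⟨c, hc, hS⟩
  have hBs' : ¬ IsStellarConnectifier G B k e := fun h => hBs ⟨k, e, rfl, h⟩
  have hA' := hA
  rcases hA with ⟨n, p, rfl, hp | hp | hp⟩ | hp | hp | hp
  case inl.inr.inr =>
    exact Or.inl (hp.isTriangularOpposite hprism hk hnohub hB hBs hBX hAB hanti hst)
  case inr.inr.inl =>
    exact Or.inl (hp.isTriangularOpposite hprism hk hB hBs hAX hAB hanti hst)
  case inr.inr.inr => exact absurd ⟨k, e, rfl, hp⟩ hAs
  all_goals rcases hB with ⟨m, q, rfl, hq | hq | hq⟩ | hq | hq | hq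
  all_goals first
    | exact Or.inr (hq.isTriangularOpposite hprism hk hnohub hA' hAs hAX hAB.symm hanti.symm hst)
    | exact Or.inr (hq.isTriangularOpposite hprism hk hA' hAs hBX hAB.symm hanti.symm hst)
    | exact absurd hq hBs'
    | exact absurd (hp.isHub hk hq.1 hst hAB hanti) hnohub
    | exact absurd (hq.isHub hk hp.1 hst hAB.symm hanti.symm) hnohub
    | exact absurd (hp.hasTheta hq hk hBX hAB hanti hst) htheta
    | exact absurd (hq.hasTheta hp hk hAX hAB.symm hanti.symm hst) htheta
    | exact absurd (hq.thetaHalf hk hst) (htwo (hp.thetaHalf hk hst))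
    | exact absurd (hconn hq) (htwo (hp.thetaHalf hk hst))
    | exact absurd (hq.thetaHalf hk hst) (htwo (hconn hp))
    | exact absurd (hconn hq) (htwo (hconn hp))

end Classification

/-- classification of a pair of consistent alignments/connectifiers on the two
sides of a stable set of non-hubs. -/
theorem stmt_13 {V : Type} [Fintype V] (G : SimpleGraph V) (hC : MemC G)
    (H1 H2 X : Set V)
    (hunion : H1 ∪ H2 ∪ X = Set.univ)
    (hd12 : Disjoint H1 H2) (hd1X : Disjoint H1 X) (hd2X : Disjoint H2 X)
    (hanti : Anticomplete G H1 H2)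
    (hstable : StableSet G X) (hX3 : 3 ≤ X.ncard)
    (hnohub : ∀ v ∈ X, ¬ IsHub G v)
    (k : ℕ) (e1 e2 : Fin k → V)
    (he1 : X = Set.range e1) (he2 : X = Set.range e2)
    (hc1 : IsConsistentWith G H1 k e1) (hc2 : IsConsistentWith G H2 k e2)
    (horder : (¬ IsStellarConnSet G H1 X ∧ ¬ IsStellarConnSet G H2 X) → e1 = e2) :
    ∃ A B : Set V, ((A = H1 ∧ B = H2) ∨ (A = H2 ∧ B = H1)) ∧
      (IsTriAlignSet G A X ∨ IsTriConnSet G A X) ∧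
      (IsSpikyConnSet G B X ∨ IsStellarConnSet G B X ∨
        IsSpikyAlignSet G B X ∨ IsWideAlignSet G B X) ∧
      (IsTriAlignSet G A X → ¬ IsWideAlignSet G B X) := by
  have hk : 3 ≤ k := by
    rw [he1, Set.ncard_range_of_injective hc1.injective] at hX3
    simpa using hX3
  suffices h : IsTriangularOpposite G X H1 H2 ∨ IsTriangularOpposite G X H2 H1 by
    rcases h with h | h
    · exact ⟨H1, H2, Or.inl ⟨rfl, rfl⟩, h⟩
    · exact ⟨H2, H1, Or.inr ⟨rfl, rfl⟩, h⟩
  by_cases hs1 : IsStellarConnSet G H1 X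
  · exact Or.inr (hs1.isTriangularOpposite hC.2.1 hk he2 hc2 hd1X hd12 hanti hstable)
  by_cases hs2 : IsStellarConnSet G H2 X
  · exact Or.inl (hs2.isTriangularOpposite hC.2.1 hk he1 hc1 hd2X hd12.symm hanti.symm hstable)
  obtain rfl := horder ⟨hs1, hs2⟩
  subst he1
  exact isTriangularOpposite_or hC.2.1 hC.2.2.1 hk (hnohub _ ⟨_, rfl⟩) hc1 hc2 hs1 hs2 hd1X hd2X
    hd12 hanti hstable
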